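/- There exists a constant C > 0, independent of ε and n, such that for every ε ∈ (0,1] and every integer n ≥ 4 divisible by 4, the nonlinear discrete scheme on the Shishkin mesh with γ₀ = min{c₀,1} has a unique solution y, and max_{0≤i≤n} |u(x_i) − y_i| ≤ C n^{−2} (ln n)², where u is the solution of the continuous problem. -/

import Mathlib

open Set Real

noncomputable section

/-- first partial derivative of `f(x,u)` with respect to `u` -/
def pderiv1 (f : ℝ → ℝ → ℝ) (x y : ℝ) : ℝ := deriv (fun z => f x z) y

/-- second partial derivative of `f(x,u)` with respect to `u` -/
def pderiv2 (f : ℝ → ℝ → ℝ) (x y : ℝ) : ℝ :=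
  deriv (fun z => deriv (fun w => f x w) z) y

/-- `f` is four times continuously differentiable on `[0,1] × ℝ`. -/
def SmoothF (f : ℝ → ℝ → ℝ) : Prop :=
  ContDiffOn ℝ 4 (fun p : ℝ × ℝ => f p.1 p.2) ((Icc (0:ℝ) 1) ×ˢ (univ : Set ℝ))

/-- the stability condition `f_u(x,u) ≥ c₀² > 0` on `[0,1] × ℝ` -/
def LowerF (f : ℝ → ℝ → ℝ) (c₀ : ℝ) : Prop :=
  ∀ x ∈ Icc (0:ℝ) 1, ∀ y : ℝ, c₀ ^ 2 ≤ pderiv1 f x y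

/-- `u` is a C⁴-solution of the semilinear BVP `-ε²u'' + f(x,u) = 0`, `u(0)=u(1)=0`. -/
def IsSolution (f : ℝ → ℝ → ℝ) (ε : ℝ) (u : ℝ → ℝ) : Prop :=
  ContDiffOn ℝ 4 u (Icc (0:ℝ) 1) ∧
  (∀ x ∈ Ioo (0:ℝ) 1,
    -ε ^ 2 * iteratedDerivWithin 2 u (Icc (0:ℝ) 1) x + f x (u x) = 0) ∧
  u 0 = 0 ∧ u 1 = 0

/-- the constant `l = c₀⁻² · max_{[0,1]} |f(x,0)|` -/
def lconst (f : ℝ → ℝ → ℝ) (c₀ : ℝ) : ℝ :=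
  c₀ ^ (-2 : ℤ) * sSup ((fun x => |f x 0|) '' Icc (0:ℝ) 1)

/-- the constant `θ = max { |f_uu(x,ξ)| : x ∈ [0,1], |ξ| ≤ l + 2ρ }` -/
def thconst (f : ℝ → ℝ → ℝ) (c₀ ρ : ℝ) : ℝ :=
  sSup ((fun p : ℝ × ℝ => |pderiv2 f p.1 p.2|) ''
    ((Icc (0:ℝ) 1) ×ˢ (Icc (-(lconst f c₀ + 2*ρ)) (lconst f c₀ + 2*ρ))))

/-- discrete second difference `y_{x̄x̂,i}` on a nonuniform mesh `x` (for `1 ≤ i`),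
using `ℏ_i = (h_i + h_{i+1})/2 = (x_{i+1} - x_{i-1})/2`. -/
def ddiff (x y : ℕ → ℝ) (i : ℕ) : ℝ :=
  2 / (x (i+1) - x (i-1)) *
    ((y (i+1) - y i) / (x (i+1) - x i) - (y i - y (i-1)) / (x i - x (i-1)))

/-- Shishkin mesh generating function with transition parameter
`α = min(1/4, 2γ₀⁻¹ ε ln n)`. -/
def shishkinLam (γ₀ ε : ℝ) (n : ℕ) (t : ℝ) : ℝ :=
  let α := min (1/4) (2 * γ₀⁻¹ * ε * Real.log n)
  if t ≤ 1/4 then 4*α*t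
  else if t ≤ 1/2 then α + 2*(1-2*α)*(t-1/4)
  else 1 - (if 1-t ≤ 1/4 then 4*α*(1-t) else α + 2*(1-2*α)*((1-t)-1/4))

/-- Shishkin mesh nodes `x_i = λ(i/n)` -/
def shishkinMesh (γ₀ ε : ℝ) (n i : ℕ) : ℝ := shishkinLam γ₀ ε n ((i:ℝ)/(n:ℝ))

def bakhPhi (a ε q t : ℝ) : ℝ := a*ε*Real.log (q/(q-t))

/-- derivative of `bakhPhi` -/
def bakhPhi' (a ε q t : ℝ) : ℝ := a*ε/(q-t)

/-- `α ∈ (0,q)` is the abscissa of the contact point of the tangent line from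
`(1/2,1/2)` to `φ`, i.e. `φ(α) + φ'(α)(1/2 - α) = 1/2`. -/
def IsBakhAlpha (a ε q α : ℝ) : Prop :=
  α ∈ Ioo 0 q ∧ bakhPhi a ε q α + bakhPhi' a ε q α * (1/2 - α) = 1/2

/-- Bakhvalov mesh generating function -/
def bakhLam (a ε q α t : ℝ) : ℝ :=
  if t ≤ α then bakhPhi a ε q t
  else if t ≤ 1/2 then bakhPhi a ε q α + bakhPhi' a ε q α * (t-α)
  else 1 - (if 1-t ≤ α then bakhPhi a ε q (1-t)
            else bakhPhi a ε q α + bakhPhi' a ε q α * ((1-t)-α))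

/-- Bakhvalov mesh nodes `x_i = λ(i/n)` -/
def bakhMesh (a ε q α : ℝ) (n i : ℕ) : ℝ := bakhLam a ε q α ((i:ℝ)/(n:ℝ))

def vulAlpha (a ε q : ℝ) : ℝ :=
  (q - Real.sqrt (ε*a*q*(1-2*q+2*ε*a)))/(1+2*ε*a)

def vulMu (a ε q t : ℝ) : ℝ := a*ε*t/(q-t)

/-- derivative of `vulMu` -/
def vulMu' (a ε q t : ℝ) : ℝ := a*ε*q/(q-t)^2

/-- Vulanović mesh generating function -/
def vulLam (a ε q t : ℝ) : ℝ :=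
  let α := vulAlpha a ε q
  if t ≤ α then vulMu a ε q t
  else if t ≤ 1/2 then vulMu a ε q α + vulMu' a ε q α * (t-α)
  else 1 - (if 1-t ≤ α then vulMu a ε q (1-t)
            else vulMu a ε q α + vulMu' a ε q α * ((1-t)-α))

/-- Vulanović mesh nodes `x_i = λ(i/n)` -/
def vulMesh (a ε q : ℝ) (n i : ℕ) : ℝ := vulLam a ε q ((i:ℝ)/(n:ℝ))

/-- the three-point discrete scheme for the linear problem
`-ε² y_{x̄x̂,i} + b(x_i) y_i = g(x_i)`, `y_0 = y_n = 0` -/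
def LinScheme (bc gc : ℝ → ℝ) (ε : ℝ) (x : ℕ → ℝ) (n : ℕ) (y : ℕ → ℝ) : Prop :=
  (∀ i : ℕ, 1 ≤ i → i < n →
    -ε ^ 2 * ddiff x y i + bc (x i) * y i = gc (x i)) ∧
  y 0 = 0 ∧ y n = 0

/-- the nonlinear discrete scheme `-ε² y_{x̄x̂,i} + f(x_i, y_i) = 0`, `y_0 = y_n = 0` -/
def NonlinScheme (f : ℝ → ℝ → ℝ) (ε : ℝ) (x : ℕ → ℝ) (n : ℕ) (y : ℕ → ℝ) : Prop :=
  (∀ i : ℕ, 1 ≤ i → i < n → -ε ^ 2 * ddiff x y i + f (x i) (y i) = 0) ∧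
  y 0 = 0 ∧ y n = 0

/-- `u` is a C²-solution of the continuous linear problem
`-ε²u'' + b(x)u = g(x)`, `u(0)=u(1)=0`. -/
def IsLinSolution (bc gc : ℝ → ℝ) (ε : ℝ) (u : ℝ → ℝ) : Prop :=
  ContDiffOn ℝ 2 u (Icc (0:ℝ) 1) ∧
  (∀ x ∈ Ioo (0:ℝ) 1,
    -ε ^ 2 * iteratedDerivWithin 2 u (Icc (0:ℝ) 1) x + bc x * u x = gc x) ∧
  u 0 = 0 ∧ u 1 = 0

/-- `b(x,ε)` is three times continuously differentiable in `x` on `[0,1]`,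
with these derivatives bounded uniformly in `ε ∈ [0,1]`. -/
def UnifC3 (b : ℝ → ℝ → ℝ) : Prop :=
  ∃ M : ℝ, ∀ ε ∈ Icc (0:ℝ) 1,
    ContDiffOn ℝ 3 (fun x => b x ε) (Icc (0:ℝ) 1) ∧
    ∀ j : ℕ, j ≤ 3 → ∀ x ∈ Icc (0:ℝ) 1,
      |iteratedDerivWithin j (fun x => b x ε) (Icc (0:ℝ) 1) x| ≤ M

/-- `w` is the continuous piecewise-linear interpolant of mesh data `y`
on the mesh `x_0 < … < x_n`. -/
def IsLinInterp (x : ℕ → ℝ) (n : ℕ) (y : ℕ → ℝ) (w : ℝ → ℝ) : Prop :=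
  (∀ i ≤ n, w (x i) = y i) ∧
  ∀ i < n, ∀ t ∈ Icc (x i) (x (i+1)),
    w t = y i + (y (i+1) - y i) * (t - x i) / (x (i+1) - x i)

/-- properties of the initial guess `u⁰`: of class C³, within `ρ` of the
solution `u`, and satisfying ε-uniform bounds of layer type for `j = 0, 1`. -/
def InitGuess (c₀ ε C₀ ρ : ℝ) (u u0 : ℝ → ℝ) : Prop :=
  ContDiffOn ℝ 3 u0 (Icc (0:ℝ) 1) ∧
  (∀ x ∈ Icc (0:ℝ) 1, |u0 x - u x| ≤ ρ) ∧
  (∀ x ∈ Icc (0:ℝ) 1, |u0 x| ≤ C₀) ∧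
  (∀ x ∈ Icc (0:ℝ) 1, |derivWithin u0 (Icc (0:ℝ) 1) x| ≤
    C₀ * (1 + ε⁻¹ * (Real.exp (-c₀*x/ε) + Real.exp (-c₀*(1-x)/ε))))

/-- the discrete Newton (quasilinearization) iterates on the mesh `x`:
`y⁰_i = u⁰(x_i)` and `y^{m+1}` solves the quasilinearized discrete problem. -/
def NewtonIter (f : ℝ → ℝ → ℝ) (ε : ℝ) (x : ℕ → ℝ) (n : ℕ) (u0 : ℝ → ℝ)
    (Y : ℕ → ℕ → ℝ) : Prop :=
  (∀ i ≤ n, Y 0 i = u0 (x i)) ∧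
  ∀ m : ℕ,
    (∀ i : ℕ, 1 ≤ i → i < n →
      -ε ^ 2 * ddiff x (Y (m+1)) i + pderiv1 f (x i) (Y m i) * Y (m+1) i
        = -f (x i) (Y m i) + pderiv1 f (x i) (Y m i) * Y m i) ∧
    Y (m+1) 0 = 0 ∧ Y (m+1) n = 0


/-- continuous minimum principle -/
theorem cont_min_principle (w w1 w2 : ℝ → ℝ) (hc : ContinuousOn w (Icc 0 1))
    (h1 : ∀ x ∈ Ioo (0:ℝ) 1, HasDerivAt w (w1 x) x)
    (h2 : ∀ x ∈ Ioo (0:ℝ) 1, HasDerivAt w1 (w2 x) x)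
    (hneg : ∀ x ∈ Ioo (0:ℝ) 1, w x < 0 → w2 x < 0)
    (h0 : 0 ≤ w 0) (hone : 0 ≤ w 1) : ∀ x ∈ Icc (0:ℝ) 1, 0 ≤ w x := by
  obtain ⟨p, hp, hmin⟩ := isCompact_Icc.exists_isMinOn (nonempty_Icc.2 (zero_le_one (α := ℝ))) hc
  intro x hx
  by_contra! hlt
  have hwp : w p < 0 := lt_of_le_of_lt (hmin hx) hlt
  have hpi : p ∈ Ioo (0:ℝ) 1 := by
    refine ⟨lt_of_le_of_ne hp.1 ?_, lt_of_le_of_ne hp.2 ?_⟩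
    · rintro rfl; linarith
    · rintro rfl; linarith
  have hnb : Icc (0:ℝ) 1 ∈ nhds p := Icc_mem_nhds hpi.1 hpi.2
  have hloc : IsLocalMin w p := hmin.isLocalMin hnb
  have hw1 : w1 p = 0 := hloc.hasDerivAt_eq_zero (h1 p hpi)
  have hw2 := hneg p hpi hwp
  have hslope := (hasDerivAt_iff_tendsto_slope.1 (h2 p hpi)).eventually (gt_mem_nhds hw2)
  rw [eventually_nhdsWithin_iff, Metric.eventually_nhds_iff] at hslope
  obtain ⟨δ, hδ, hs⟩ := hslope
  obtain ⟨q, hq1, hq2⟩ : ∃ q, p < q ∧ q < min (p + δ) 1 :=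
    exists_between (lt_min (by linarith) hpi.2)
  have hq3 := lt_of_lt_of_le hq2 (min_le_left _ _)
  have hq4 := lt_of_lt_of_le hq2 (min_le_right _ _)
  obtain ⟨t, ht, hslp⟩ := exists_hasDerivAt_eq_slope w w1 hq1
    (hc.mono (Icc_subset_Icc hp.1 hq4.le))
    (fun y hy => h1 y ⟨by linarith [hy.1, hpi.1], by linarith [hy.2]⟩)
  have h3 := hs (y := t) (by rw [Real.dist_eq, abs_of_pos (by linarith [ht.1])]; linarith [ht.2])
    (by simpa using ht.1.ne')
  rw [slope_def_field, hw1, div_neg_iff] at h3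
  have h4 : w1 t < 0 := by
    rcases h3 with h3 | h3
    · linarith [ht.1]
    · linarith
  have h5 : w p ≤ w q := hmin ⟨by linarith [hpi.1], hq4.le⟩
  have h6 : 0 ≤ (w q - w p) / (q - p) := div_nonneg (by linarith) (by linarith)
  linarith

/-- interpolation inequality for the first derivative -/
theorem interp_bound (g g1 g2 : ℝ → ℝ) (ε x P Q : ℝ) (hε : 0 < ε) (hε1 : ε ≤ 1)
    (hx : x ∈ Icc (0:ℝ) 1)
    (h1 : ∀ t ∈ Icc (0:ℝ) 1, HasDerivWithinAt g (g1 t) (Icc 0 1) t)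
    (h2 : ∀ t ∈ Icc (0:ℝ) 1, HasDerivWithinAt g1 (g2 t) (Icc 0 1) t)
    (hP : ∀ t ∈ Icc (0:ℝ) 1, |t - x| ≤ ε / 2 → |g t| ≤ P)
    (hQ : ∀ t ∈ Icc (0:ℝ) 1, |t - x| ≤ ε / 2 → |g2 t| ≤ Q) :
    |g1 x| ≤ 4 * P / ε + Q * ε / 2 := by
  obtain ⟨a, ha0, ha1, hxa, hxb⟩ : ∃ a : ℝ, 0 ≤ a ∧ a + ε / 2 ≤ 1 ∧ a ≤ x ∧ x ≤ a + ε / 2 := by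
    by_cases h : x + ε / 2 ≤ 1
    · exact ⟨x, hx.1, h, le_rfl, by linarith⟩
    · exact ⟨x - ε / 2, by linarith, by linarith [hx.2], by linarith, by linarith⟩
  have hsub : Icc a (a + ε / 2) ⊆ Icc (0:ℝ) 1 := Icc_subset_Icc ha0 ha1
  have hab : a < a + ε / 2 := by linarith
  have hclose : ∀ t ∈ Icc a (a + ε / 2), |t - x| ≤ ε / 2 := by
    intro t ht
    rw [abs_le]; constructor <;> linarith [ht.1, ht.2]
  obtain ⟨t, ht, hslp⟩ := exists_hasDerivAt_eq_slope g g1 hab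
    (fun y hy => ((h1 y (hsub hy)).continuousWithinAt).mono hsub)
    (fun y hy => (h1 y (hsub (Ioo_subset_Icc_self hy))).hasDerivAt
      (Icc_mem_nhds (by linarith [hy.1]) (by linarith [hy.2])))
  have htI := Ioo_subset_Icc_self ht
  have hb : |g1 t| ≤ 4 * P / ε := by
    rw [hslp, abs_div, add_sub_cancel_left, abs_of_pos (by linarith : (0:ℝ) < ε / 2),
      div_le_div_iff₀ (by linarith) hε]
    have e1 := abs_sub (g (a + ε / 2)) (g a)
    have e2 := hP _ (hsub (right_mem_Icc.2 hab.le)) (hclose _ (right_mem_Icc.2 hab.le))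
    have e3 := hP _ (hsub (left_mem_Icc.2 hab.le)) (hclose _ (left_mem_Icc.2 hab.le))
    nlinarith
  have hd := (convex_Icc a (a + ε / 2)).norm_image_sub_le_of_norm_hasDerivWithin_le
    (f := g1) (f' := g2) (C := Q) (fun y hy => (h2 y (hsub hy)).mono hsub)
    (fun y hy => hQ y (hsub hy) (hclose y hy)) htI ⟨hxa, hxb⟩
  rw [Real.norm_eq_abs, Real.norm_eq_abs] at hd
  have hQ0 : 0 ≤ Q := (abs_nonneg _).trans (hQ x hx (by simp; linarith))
  have hcl := hclose t htI
  rw [abs_sub_comm] at hcl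
  have := abs_sub_abs_le_abs_sub (g1 x) (g1 t)
  nlinarith

theorem step_bound (g g' : ℝ → ℝ) (h K : ℝ) (k : ℕ) (hK : 0 ≤ K)
    (hd : ∀ s ∈ Icc (0:ℝ) h, HasDerivWithinAt g (g' s) (Icc 0 h) s) (h0 : g 0 = 0)
    (hb : ∀ s ∈ Icc (0:ℝ) h, |g' s| ≤ K * s ^ k) :
    ∀ s ∈ Icc (0:ℝ) h, |g s| ≤ K * s ^ (k + 1) := by
  intro s hs
  have hsub : Icc 0 s ⊆ Icc 0 h := Icc_subset_Icc_right hs.2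
  have := (convex_Icc 0 s).norm_image_sub_le_of_norm_hasDerivWithin_le
    (f := g) (f' := g') (C := K * s ^ k) (fun y hy => (hd y (hsub hy)).mono hsub)
    (fun y hy => (hb y (hsub hy)).trans (by
      have := pow_le_pow_left₀ hy.1 hy.2 k
      gcongr)) (left_mem_Icc.2 hs.1) (right_mem_Icc.2 hs.1)
  rw [h0, sub_zero, sub_zero, Real.norm_eq_abs, Real.norm_eq_abs, abs_of_nonneg hs.1] at this
  calc |g s| ≤ _ := this
    _ = _ := by ring

theorem taylor_A (v v1 v2 : ℝ → ℝ) (h P : ℝ) (hh : 0 ≤ h)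
    (d1 : ∀ s ∈ Icc (0:ℝ) h, HasDerivWithinAt v (v1 s) (Icc 0 h) s)
    (d2 : ∀ s ∈ Icc (0:ℝ) h, HasDerivWithinAt v1 (v2 s) (Icc 0 h) s)
    (k : ℕ) (hP : 0 ≤ P)
    (hb : ∀ s ∈ Icc (0:ℝ) h, |v2 s - v2 0| ≤ P * s ^ k) :
    |v h - v 0 - h * v1 0 - h ^ 2 / 2 * v2 0| ≤ P * h ^ (k + 2) := by
  have a1 := step_bound (fun s => v1 s - v1 0 - s * v2 0) (fun s => v2 s - v2 0) h P k hP
    (fun s hs => by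
      have := ((d2 s hs).sub_const (v1 0)).sub (((hasDerivAt_id s).mul_const (v2 0)).hasDerivWithinAt)
      exact this.congr_deriv (by simp)) (by simp) hb
  have a2 := step_bound (fun s => v s - v 0 - s * v1 0 - s ^ 2 / 2 * v2 0)
    (fun s => v1 s - v1 0 - s * v2 0) h P (k + 1) hP
    (fun s hs => by
      have := (((d1 s hs).sub_const (v 0)).sub
        (((hasDerivAt_id s).mul_const (v1 0)).hasDerivWithinAt)).sub
        (((((hasDerivAt_id s).pow 2).div_const 2).mul_const (v2 0)).hasDerivWithinAt)
      refine this.congr_deriv ?_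
      simp) (by simp) a1
  exact a2 h ⟨hh, le_rfl⟩

theorem taylor_C (v v1 v2 v3 v4 : ℝ → ℝ) (h Q : ℝ) (hh : 0 ≤ h) (hQ : 0 ≤ Q)
    (d1 : ∀ s ∈ Icc (0:ℝ) h, HasDerivWithinAt v (v1 s) (Icc 0 h) s)
    (d2 : ∀ s ∈ Icc (0:ℝ) h, HasDerivWithinAt v1 (v2 s) (Icc 0 h) s)
    (d3 : ∀ s ∈ Icc (0:ℝ) h, HasDerivWithinAt v2 (v3 s) (Icc 0 h) s)
    (d4 : ∀ s ∈ Icc (0:ℝ) h, HasDerivWithinAt v3 (v4 s) (Icc 0 h) s)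
    (hb : ∀ s ∈ Icc (0:ℝ) h, |v4 s| ≤ Q) :
    |v h - v 0 - h * v1 0 - h ^ 2 / 2 * v2 0 - h ^ 3 / 6 * v3 0| ≤ Q * h ^ 4 := by
  have a0 := step_bound (fun s => v3 s - v3 0) v4 h Q 0 hQ
    (fun s hs => (d4 s hs).sub_const (v3 0)) (by simp) (by simpa using hb)
  have a1 := step_bound (fun s => v2 s - v2 0 - s * v3 0) (fun s => v3 s - v3 0) h Q 1 hQ
    (fun s hs => by
      have := ((d3 s hs).sub_const (v2 0)).sub (((hasDerivAt_id s).mul_const (v3 0)).hasDerivWithinAt)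
      exact this.congr_deriv (by simp)) (by simp) a0
  have := taylor_A (fun s => v s - s ^ 3 / 6 * v3 0) (fun s => v1 s - s ^ 2 / 2 * v3 0)
    (fun s => v2 s - s * v3 0) h Q hh
    (fun s hs => by
      have := (d1 s hs).sub
        (((((hasDerivAt_id s).pow 3).div_const 6).mul_const (v3 0)).hasDerivWithinAt)
      refine this.congr_deriv ?_
      show v1 s - ((3:ℕ):ℝ) * s ^ 2 * 1 / 6 * v3 0 = _
      push_cast; ring)
    (fun s hs => by
      have := (d2 s hs).sub
        (((((hasDerivAt_id s).pow 2).div_const 2).mul_const (v3 0)).hasDerivWithinAt)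
      refine this.congr_deriv ?_
      simp) 2 hQ
    (fun s hs => by
      have := a1 s hs
      rw [show v2 s - s * v3 0 - (v2 0 - 0 * v3 0) = v2 s - v2 0 - s * v3 0 by ring]
      exact this)
  have e : v h - v 0 - h * v1 0 - h ^ 2 / 2 * v2 0 - h ^ 3 / 6 * v3 0 =
    v h - h ^ 3 / 6 * v3 0 - (v 0 - 0 ^ 3 / 6 * v3 0) - h * (v1 0 - 0 ^ 2 / 2 * v3 0) -
      h ^ 2 / 2 * (v2 0 - 0 * v3 0) := by ring
  rw [e]; exact this

/-- discrete nonlinear comparison principle -/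
theorem disc_comparison (f : ℝ → ℝ → ℝ) (ε : ℝ) (x : ℕ → ℝ) (n : ℕ) (Y Z : ℕ → ℝ)
    (hx : ∀ i < n, x i < x (i + 1))
    (hf : ∀ i ≤ n, ∀ a b, a < b → f (x i) a < f (x i) b)
    (h : ∀ i, 1 ≤ i → i < n →
      -ε ^ 2 * ddiff x Z i + f (x i) (Z i) ≤ -ε ^ 2 * ddiff x Y i + f (x i) (Y i))
    (h0 : Z 0 ≤ Y 0) (hn : Z n ≤ Y n) : ∀ i ≤ n, Z i ≤ Y i := by
  obtain ⟨p, hp, hmin⟩ := Finset.exists_min_image (Finset.range (n + 1)) (fun i => Y i - Z i)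
    ⟨0, by simp⟩
  intro i hi
  by_contra! hlt
  have hpn : p ≤ n := by simpa [Nat.lt_succ_iff] using hp
  have hmin' : ∀ j ≤ n, Y p - Z p ≤ Y j - Z j := fun j hj => hmin j (by simp; omega)
  have hneg : Y p < Z p := by linarith [hmin' i hi]
  have hp1 : 1 ≤ p := by
    rcases Nat.eq_zero_or_pos p with h | h
    · subst h; linarith
    · exact h
  have hp2 : p < n := lt_of_le_of_ne hpn (by rintro rfl; linarith)
  have hh := h p hp1 hp2
  have hff := hf p hpn _ _ hneg
  have a1 := hmin' (p + 1) hp2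
  have a2 := hmin' (p - 1) (by omega)
  have b1 := hx p hp2
  have b2 := hx (p - 1) (by omega)
  rw [Nat.sub_add_cancel hp1] at b2
  have key : ddiff x Z p ≤ ddiff x Y p := by
    unfold ddiff
    have c1 : (Z (p+1) - Z p) / (x (p+1) - x p) ≤ (Y (p+1) - Y p) / (x (p+1) - x p) :=
      div_le_div_of_nonneg_right (by linarith) (by linarith)
    have c2 : (Y p - Y (p-1)) / (x p - x (p-1)) ≤ (Z p - Z (p-1)) / (x p - x (p-1)) :=
      div_le_div_of_nonneg_right (by linarith) (by linarith)
    exact mul_le_mul_of_nonneg_left (by linarith) (div_nonneg (by norm_num) (by linarith))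
  have := mul_le_mul_of_nonneg_left key (sq_nonneg ε)
  linarith

/-- shooting sequence: `(y i, y (i+1))` -/
def shoot (f : ℝ → ℝ → ℝ) (ε : ℝ) (x : ℕ → ℝ) (s : ℝ) : ℕ → ℝ × ℝ
  | 0 => (0, s)
  | i + 1 => ((shoot f ε x s i).2, (shoot f ε x s i).2 + (x (i+2) - x (i+1)) *
      (((shoot f ε x s i).2 - (shoot f ε x s i).1) / (x (i+1) - x i) +
        (x (i+2) - x i) / 2 * (f (x (i+1)) (shoot f ε x s i).2 / ε ^ 2)))

theorem shoot_cont (f : ℝ → ℝ → ℝ) (ε : ℝ) (x : ℕ → ℝ) (n : ℕ)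
    (hf : ∀ i ≤ n, Continuous (f (x i))) : ∀ i, i ≤ n →
    Continuous (fun s => (shoot f ε x s i).1) ∧ Continuous (fun s => (shoot f ε x s i).2) := by
  intro i
  induction i with
  | zero => intro _; exact ⟨continuous_const, continuous_id⟩
  | succ i ih =>
    intro hi
    obtain ⟨h1, h2⟩ := ih (by omega)
    refine ⟨h2, ?_⟩
    have h3 : Continuous (fun s => f (x (i+1)) (shoot f ε x s i).2) := (hf (i+1) hi).comp h2
    simp only [shoot]
    fun_prop

theorem shoot_mono (f : ℝ → ℝ → ℝ) (ε : ℝ) (x : ℕ → ℝ) (n : ℕ)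
    (hx : ∀ i < n, x i < x (i + 1))
    (hf : ∀ i ≤ n, Monotone (f (x i))) (s t : ℝ) (hst : s ≤ t) : ∀ i, i + 1 ≤ n →
    0 ≤ (shoot f ε x t i).1 - (shoot f ε x s i).1 ∧
    (shoot f ε x t i).1 - (shoot f ε x s i).1 ≤ (shoot f ε x t i).2 - (shoot f ε x s i).2 ∧
    t - s ≤ (shoot f ε x t i).2 - (shoot f ε x s i).2 := by
  intro i
  induction i with
  | zero => intro _; simp [shoot, hst]
  | succ i ih =>
    intro hi
    obtain ⟨h1, h2, h3⟩ := ih (by omega)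
    have b1 := hx (i+1) (by omega)
    have b2 := hx i (by omega)
    have hm := hf (i+1) (by omega) (show (shoot f ε x s i).2 ≤ (shoot f ε x t i).2 by linarith)
    have c1 : ((shoot f ε x s i).2 - (shoot f ε x s i).1) / (x (i+1) - x i) ≤
      ((shoot f ε x t i).2 - (shoot f ε x t i).1) / (x (i+1) - x i) :=
      div_le_div_of_nonneg_right (by linarith) (by linarith)
    have c2 : f (x (i+1)) (shoot f ε x s i).2 / ε ^ 2 ≤ f (x (i+1)) (shoot f ε x t i).2 / ε ^ 2 :=
      div_le_div_of_nonneg_right hm (sq_nonneg ε)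
    have c3 := mul_le_mul_of_nonneg_left c2 (show 0 ≤ (x (i+2) - x i) / 2 by
      have : x (i+1) < x (i+2) := b1
      linarith)
    have c4 := mul_le_mul_of_nonneg_left (add_le_add c1 c3) (show 0 ≤ x (i+2) - x (i+1) by
      have : x (i+1) < x (i+2) := b1
      linarith)
    simp only [shoot]
    exact ⟨by linarith, by linarith, by linarith⟩

theorem disc_exists (f : ℝ → ℝ → ℝ) (ε : ℝ) (x : ℕ → ℝ) (n : ℕ) (hn : 1 ≤ n) (hε : 0 < ε)
    (hx : ∀ i < n, x i < x (i + 1))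
    (hfc : ∀ i ≤ n, Continuous (f (x i)))
    (hf : ∀ i ≤ n, Monotone (f (x i))) : ∃ y, NonlinScheme f ε x n y := by
  obtain ⟨m, rfl⟩ : ∃ m, n = m + 1 := ⟨n - 1, by omega⟩
  have hcont := (shoot_cont f ε x (m+1) hfc m (by omega)).2
  set g := fun s => (shoot f ε x s m).2 with hg
  have hgm : ∀ s t, s ≤ t → t - s ≤ g t - g s := fun s t hst =>
    (shoot_mono f ε x (m+1) hx hf s t hst m le_rfl).2.2
  have e1 := hgm 0 |g 0| (abs_nonneg _)
  have e2 := hgm (-|g 0|) 0 (by simp)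
  have e3 := neg_abs_le (g 0)
  have e4 := le_abs_self (g 0)
  obtain ⟨s, -, hs⟩ := intermediate_value_Icc (f := g) (a := -|g 0|) (b := |g 0|)
    (by linarith [abs_nonneg (g 0)]) hcont.continuousOn
    (show (0:ℝ) ∈ Icc _ _ from ⟨by linarith, by linarith⟩)
  refine ⟨fun i => (shoot f ε x s i).1, ?_, rfl, hs⟩
  intro i hi1 hi2
  obtain ⟨j, rfl⟩ : ∃ j, i = j + 1 := ⟨i - 1, by omega⟩
  have b1 : x (j+1) < x (j+2) := hx (j+1) hi2
  have b2 := hx j (by omega)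
  simp only [ddiff, Nat.add_sub_cancel, shoot]
  have n1 : x (j+1+1) - x (j+1) ≠ 0 := by
    have : x (j+1) < x (j+1+1) := b1
    linarith
  have n2 : x (j+1) - x j ≠ 0 := by linarith
  have n3 : x (j+1+1) - x j ≠ 0 := by
    have : x (j+1) < x (j+1+1) := b1
    linarith
  show -ε ^ 2 * (2 / (x (j+1+1) - x j) * (((shoot f ε x s j).2 + (x (j+1+1) - x (j+1)) *
      (((shoot f ε x s j).2 - (shoot f ε x s j).1) / (x (j+1) - x j) +
        (x (j+1+1) - x j) / 2 * (f (x (j+1)) (shoot f ε x s j).2 / ε ^ 2)) - (shoot f ε x s j).2) /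
        (x (j+1+1) - x (j+1)) - _)) + _ = 0
  rw [add_sub_cancel_left, mul_div_cancel_left₀ _ n1, add_sub_cancel_left]
  field_simp
  ring

theorem lin_barrier (ε : ℝ) (hε : 0 < ε) (z z1 z2 ψ ψ1 ψ2 b r : ℝ → ℝ)
    (d1 : ∀ t ∈ Icc (0:ℝ) 1, HasDerivWithinAt z (z1 t) (Icc 0 1) t)
    (d2 : ∀ t ∈ Icc (0:ℝ) 1, HasDerivWithinAt z1 (z2 t) (Icc 0 1) t)
    (e1 : ∀ t, HasDerivAt ψ (ψ1 t) t) (e2 : ∀ t, HasDerivAt ψ1 (ψ2 t) t)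
    (hb : ∀ t ∈ Icc (0:ℝ) 1, 0 < b t)
    (heq : ∀ t ∈ Icc (0:ℝ) 1, ε ^ 2 * z2 t = b t * z t + r t)
    (hr : ∀ t ∈ Icc (0:ℝ) 1, |r t| ≤ b t * ψ t - ε ^ 2 * ψ2 t)
    (h0 : |z 0| ≤ ψ 0) (h1 : |z 1| ≤ ψ 1) : ∀ t ∈ Icc (0:ℝ) 1, |z t| ≤ ψ t := by
  have hzc : ContinuousOn z (Icc 0 1) := fun t ht => (d1 t ht).continuousWithinAt
  have hψc : ContinuousOn ψ (Icc 0 1) := fun t _ => (e1 t).continuousAt.continuousWithinAt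
  have D1 : ∀ t ∈ Ioo (0:ℝ) 1, HasDerivAt z (z1 t) t := fun t ht =>
    (d1 t (Ioo_subset_Icc_self ht)).hasDerivAt (Icc_mem_nhds ht.1 ht.2)
  have D2 : ∀ t ∈ Ioo (0:ℝ) 1, HasDerivAt z1 (z2 t) t := fun t ht =>
    (d2 t (Ioo_subset_Icc_self ht)).hasDerivAt (Icc_mem_nhds ht.1 ht.2)
  have hε2 : 0 < ε ^ 2 := by positivity
  rw [abs_le] at h0 h1
  have A := cont_min_principle (fun t => ψ t - z t) (fun t => ψ1 t - z1 t) (fun t => ψ2 t - z2 t)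
    (hψc.sub hzc) (fun t ht => (e1 t).sub (D1 t ht)) (fun t ht => (e2 t).sub (D2 t ht))
    (fun t ht hneg => by
      have htI := Ioo_subset_Icc_self ht
      have q1 := heq t htI
      have q2 := (abs_le.1 (hr t htI)).1
      have q3 := mul_neg_of_pos_of_neg (hb t htI) hneg
      by_contra! hc
      have := mul_nonneg hε2.le hc
      nlinarith) (by simpa using h0.2) (by simpa using h1.2)
  have B := cont_min_principle (fun t => ψ t + z t) (fun t => ψ1 t + z1 t) (fun t => ψ2 t + z2 t)
    (hψc.add hzc) (fun t ht => (e1 t).add (D1 t ht)) (fun t ht => (e2 t).add (D2 t ht))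
    (fun t ht hneg => by
      have htI := Ioo_subset_Icc_self ht
      have q1 := heq t htI
      have q2 := (abs_le.1 (hr t htI)).2
      have q3 := mul_neg_of_pos_of_neg (hb t htI) hneg
      by_contra! hc
      have := mul_nonneg hε2.le hc
      nlinarith) (by linarith [h0.1]) (by linarith [h1.1])
  intro t ht
  rw [abs_le]
  exact ⟨by linarith [B t ht], by linarith [A t ht]⟩

/-- boundary layer function -/
def layer (c ε x : ℝ) : ℝ := Real.exp (-c * x / ε) + Real.exp (-c * (1 - x) / ε)

theorem two_sub_sq_nonneg (E : ℝ) (h0 : 0 < E) (h1 : E ≤ 1) : 0 ≤ 2 * E - E ^ 2 := by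
  nlinarith

set_option maxHeartbeats 2000000 in
theorem reg_abs (c M L : ℝ) (hc : 0 < c) (hM : 0 < M) (hL : 0 ≤ L) :
    ∃ K : ℝ, 0 < K ∧ ∀ ε ∈ Ioc (0:ℝ) 1, ∀ u u1 u2 u3 u4 a b R : ℝ → ℝ,
      (∀ t ∈ Icc (0:ℝ) 1, HasDerivWithinAt u (u1 t) (Icc 0 1) t) →
      (∀ t ∈ Icc (0:ℝ) 1, HasDerivWithinAt u1 (u2 t) (Icc 0 1) t) →
      (∀ t ∈ Icc (0:ℝ) 1, HasDerivWithinAt u2 (u3 t) (Icc 0 1) t) →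
      (∀ t ∈ Icc (0:ℝ) 1, HasDerivWithinAt u3 (u4 t) (Icc 0 1) t) →
      (∀ t ∈ Icc (0:ℝ) 1, |u t| ≤ L) →
      (∀ t ∈ Icc (0:ℝ) 1, |u2 t| ≤ M / ε ^ 2) →
      (∀ t ∈ Icc (0:ℝ) 1, ε ^ 2 * u3 t = b t * u1 t + a t) →
      (∀ t ∈ Icc (0:ℝ) 1, ε ^ 2 * u4 t = b t * u2 t + R t) →
      (∀ t ∈ Icc (0:ℝ) 1, |a t| ≤ M) →
      (∀ t ∈ Icc (0:ℝ) 1, c ^ 2 ≤ b t) → (∀ t ∈ Icc (0:ℝ) 1, b t ≤ M) →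
      (∀ t ∈ Icc (0:ℝ) 1, |R t| ≤ M * (1 + u1 t ^ 2)) →
      ∀ t ∈ Icc (0:ℝ) 1,
        |u2 t| ≤ K * (1 + layer c ε t / ε ^ 2) ∧
        |u3 t| ≤ K / ε * (1 + layer c ε t / ε ^ 2) ∧
        |u4 t| ≤ K / ε ^ 2 * (1 + layer c ε t / ε ^ 2) := by
  set B : ℝ := 4 * L + M / 2 with hB
  have hB0 : 0 < B := by positivity
  set A : ℝ := M / c ^ 2 with hA
  have hA0 : 0 < A := by positivity
  set A2 : ℝ := M * (1 + 2 * A ^ 2) / c ^ 2 with hA2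
  have hA20 : 0 < A2 := by positivity
  set B2 : ℝ := 4 * M * B ^ 2 / (3 * c ^ 2) + M with hB2
  have hB20 : 0 < B2 := by positivity
  set K' : ℝ := A2 + 2 * B2 + (M * (A2 + 2 * B2) + M * (1 + 2 * A ^ 2 + 4 * B ^ 2)) with hK'
  have hK'0 : 0 < K' := by positivity
  set κ : ℝ := Real.exp (c / 2) with hκ
  have hκ1 : 1 ≤ κ := Real.one_le_exp (by positivity)
  refine ⟨K' + 5 * K' * κ, by positivity, ?_⟩
  intro ε hε u u1 u2 u3 u4 a b R d1 d2 d3 d4 hu hu2 h3 h4 ha hb hbM hR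
  obtain ⟨hε0, hε1⟩ := hε
  have hc2 : 0 < c ^ 2 := by positivity
  set E1 : ℝ → ℝ := fun x => Real.exp (-c * x / ε) with hE1
  set E2 : ℝ → ℝ := fun x => Real.exp (-c * (1 - x) / ε) with hE2
  have dE1 : ∀ t, HasDerivAt E1 (-(c / ε) * E1 t) t := fun t => by
    have := (((hasDerivAt_id t).const_mul (-c)).div_const ε).exp
    refine this.congr_deriv ?_
    simp [hE1]; try ring
  have dE2 : ∀ t, HasDerivAt E2 ((c / ε) * E2 t) t := fun t => by
    have := ((((hasDerivAt_id t).const_sub 1).const_mul (-c)).div_const ε).exp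
    refine this.congr_deriv ?_
    simp [hE2]; try ring
  have pE1 : ∀ t, 0 < E1 t := fun t => Real.exp_pos _
  have pE2 : ∀ t, 0 < E2 t := fun t => Real.exp_pos _
  have lE1 : ∀ t ∈ Icc (0:ℝ) 1, E1 t ≤ 1 := fun t ht => by
    apply Real.exp_le_one_iff.2
    have : 0 ≤ c * t / ε := div_nonneg (mul_nonneg hc.le ht.1) hε0.le
    have e : -c * t / ε = -(c * t / ε) := by ring
    linarith
  have lE2 : ∀ t ∈ Icc (0:ℝ) 1, E2 t ≤ 1 := fun t ht => by
    apply Real.exp_le_one_iff.2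
    have : 0 ≤ c * (1 - t) / ε := div_nonneg (mul_nonneg hc.le (by linarith [ht.2])) hε0.le
    have e : -c * (1 - t) / ε = -(c * (1 - t) / ε) := by ring
    linarith
  have E10 : E1 0 = 1 := by simp [hE1]
  have E21 : E2 1 = 1 := by simp [hE2]
  have z01 : (0:ℝ) ∈ Icc (0:ℝ) 1 := by simp
  have o01 : (1:ℝ) ∈ Icc (0:ℝ) 1 := by simp
  have hlay : ∀ t, layer c ε t = E1 t + E2 t := fun t => rfl
  -- first crude bound on u1
  have s1 : ∀ t ∈ Icc (0:ℝ) 1, |u1 t| ≤ B / ε := by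
    intro t ht
    have := interp_bound u u1 u2 ε t L (M / ε ^ 2) hε0 hε1 ht d1 d2 (fun s hs _ => hu s hs)
      (fun s hs _ => hu2 s hs)
    calc _ ≤ _ := this
      _ = B / ε := by rw [hB]; field_simp
  have hbpos : ∀ t ∈ Icc (0:ℝ) 1, 0 < b t := fun t ht => lt_of_lt_of_le hc2 (hb t ht)
  have s2 : ∀ t ∈ Icc (0:ℝ) 1, |u1 t| ≤ A + B / ε * (E1 t + E2 t) := by
    refine lin_barrier ε hε0 u1 u2 u3 (fun t => A + B / ε * (E1 t + E2 t))
      (fun t => B / ε * (-(c / ε) * E1 t + (c / ε) * E2 t))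
      (fun t => B / ε * (-(c / ε) * (-(c / ε) * E1 t) + (c / ε) * ((c / ε) * E2 t))) b a d2 d3
      (fun t => (((dE1 t).add (dE2 t)).const_mul _).const_add _)
      (fun t => (((dE1 t).const_mul _).add ((dE2 t).const_mul _)).const_mul _) hbpos h3 ?_ ?_ ?_
    · intro t ht
      have e : ε ^ 2 * (B / ε * (-(c / ε) * (-(c / ε) * E1 t) + (c / ε) * ((c / ε) * E2 t))) =
          c ^ 2 * (B / ε * (E1 t + E2 t)) := by field_simp
      rw [e]
      have e2 : c ^ 2 * A = M := by rw [hA]; field_simp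
      have := ha t ht
      have q1 := mul_le_mul_of_nonneg_right (hb t ht) hA0.le
      have q2 := mul_le_mul_of_nonneg_right (hb t ht)
        (show 0 ≤ B / ε * (E1 t + E2 t) from mul_nonneg (by positivity) (by linarith [pE1 t, pE2 t]))
      linarith
    · have q := s1 0 z01
      have q2 : B / ε * 1 ≤ B / ε * (E1 0 + E2 0) :=
        mul_le_mul_of_nonneg_left (by linarith [pE2 0]) (by positivity)
      linarith
    · have q := s1 1 o01
      have q2 : B / ε * 1 ≤ B / ε * (E1 1 + E2 1) :=
        mul_le_mul_of_nonneg_left (by linarith [pE1 1]) (by positivity)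
      linarith
  have s2' : ∀ t ∈ Icc (0:ℝ) 1, u1 t ^ 2 ≤ 2 * A ^ 2 + 4 * B ^ 2 / ε ^ 2 * (E1 t ^ 2 + E2 t ^ 2) := by
    intro t ht
    have q := pow_le_pow_left₀ (abs_nonneg _) (s2 t ht) 2
    rw [sq_abs] at q
    have e : 4 * B ^ 2 / ε ^ 2 * (E1 t ^ 2 + E2 t ^ 2) =
      4 * ((B / ε * E1 t) ^ 2 + (B / ε * E2 t) ^ 2) := by ring
    rw [e]
    rw [mul_add] at q
    nlinarith [sq_nonneg (A - (B / ε * E1 t + B / ε * E2 t)),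
      sq_nonneg (B / ε * E1 t - B / ε * E2 t)]
  have s3 : ∀ t ∈ Icc (0:ℝ) 1, |u2 t| ≤ A2 + B2 / ε ^ 2 *
      ((2 * E1 t - E1 t ^ 2) + (2 * E2 t - E2 t ^ 2)) := by
    have de : ∀ t, HasDerivAt (fun t => E1 t ^ 2) (2 * (-(c / ε)) * E1 t ^ 2) t := fun t => by
      refine ((dE1 t).pow 2).congr_deriv ?_
      simp; ring
    have de' : ∀ t, HasDerivAt (fun t => E2 t ^ 2) (2 * (c / ε) * E2 t ^ 2) t := fun t => by
      refine ((dE2 t).pow 2).congr_deriv ?_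
      simp; ring
    refine lin_barrier ε hε0 u2 u3 u4
      (fun t => A2 + B2 / ε ^ 2 * ((2 * E1 t - E1 t ^ 2) + (2 * E2 t - E2 t ^ 2)))
      (fun t => B2 / ε ^ 2 * ((2 * (-(c / ε) * E1 t) - 2 * (-(c / ε)) * E1 t ^ 2) +
        (2 * ((c / ε) * E2 t) - 2 * (c / ε) * E2 t ^ 2)))
      (fun t => B2 / ε ^ 2 * ((2 * (-(c / ε) * (-(c / ε) * E1 t)) -
          2 * (-(c / ε)) * (2 * (-(c / ε)) * E1 t ^ 2)) +
        (2 * ((c / ε) * ((c / ε) * E2 t)) - 2 * (c / ε) * (2 * (c / ε) * E2 t ^ 2)))) b R d3 d4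
      (fun t => (((((dE1 t).const_mul _).sub (de t)).add
        (((dE2 t).const_mul _).sub (de' t))).const_mul _).const_add _)
      (fun t => ((((((dE1 t).const_mul _).const_mul _).sub ((de t).const_mul _)).add
        ((((dE2 t).const_mul _).const_mul _).sub ((de' t).const_mul _))).const_mul _))
      hbpos h4 ?_ ?_ ?_
    · intro t ht
      have e : ε ^ 2 * (B2 / ε ^ 2 * ((2 * (-(c / ε) * (-(c / ε) * E1 t)) -
          2 * (-(c / ε)) * (2 * (-(c / ε)) * E1 t ^ 2)) +
        (2 * ((c / ε) * ((c / ε) * E2 t)) - 2 * (c / ε) * (2 * (c / ε) * E2 t ^ 2)))) =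
          c ^ 2 * (B2 / ε ^ 2 * ((2 * E1 t - E1 t ^ 2) + (2 * E2 t - E2 t ^ 2))) -
          3 * c ^ 2 * (B2 / ε ^ 2 * (E1 t ^ 2 + E2 t ^ 2)) := by field_simp; ring
      rw [e]
      have hq1 : 0 ≤ 2 * E1 t - E1 t ^ 2 := two_sub_sq_nonneg _ (pE1 t) (lE1 t ht)
      have hq2 : 0 ≤ 2 * E2 t - E2 t ^ 2 := two_sub_sq_nonneg _ (pE2 t) (lE2 t ht)
      have q1 := mul_le_mul_of_nonneg_right (hb t ht) hA20.le
      have q2 := mul_le_mul_of_nonneg_right (hb t ht)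
        (show 0 ≤ B2 / ε ^ 2 * ((2 * E1 t - E1 t ^ 2) + (2 * E2 t - E2 t ^ 2)) from
          mul_nonneg (by positivity) (by linarith))
      have e2 : c ^ 2 * A2 = M * (1 + 2 * A ^ 2) := by rw [hA2]; field_simp
      have q3 : M * (4 * B ^ 2 / ε ^ 2 * (E1 t ^ 2 + E2 t ^ 2)) ≤
          3 * c ^ 2 * (B2 / ε ^ 2 * (E1 t ^ 2 + E2 t ^ 2)) := by
        have e3 : 3 * c ^ 2 * (B2 / ε ^ 2 * (E1 t ^ 2 + E2 t ^ 2)) =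
          M * (4 * B ^ 2 / ε ^ 2 * (E1 t ^ 2 + E2 t ^ 2)) +
          3 * c ^ 2 * M * ((E1 t ^ 2 + E2 t ^ 2) / ε ^ 2) := by
            rw [hB2]; field_simp
        rw [e3]
        have : 0 ≤ 3 * c ^ 2 * M * ((E1 t ^ 2 + E2 t ^ 2) / ε ^ 2) := by positivity
        linarith
      have q4 := hR t ht
      have q5 := mul_le_mul_of_nonneg_left (s2' t ht) hM.le
      linarith
    · have q := hu2 0 z01
      have hq2 : 0 ≤ 2 * E2 0 - E2 0 ^ 2 := two_sub_sq_nonneg _ (pE2 0) (lE2 0 z01)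
      have q2 : B2 / ε ^ 2 * 1 ≤ B2 / ε ^ 2 * ((2 * E1 0 - E1 0 ^ 2) + (2 * E2 0 - E2 0 ^ 2)) := by
        refine mul_le_mul_of_nonneg_left ?_ (by positivity)
        rw [E10]; linarith
      have q3 : M / ε ^ 2 ≤ B2 / ε ^ 2 :=
        div_le_div_of_nonneg_right (by rw [hB2]; linarith [show 0 ≤ 4 * M * B ^ 2 / (3 * c ^ 2) by positivity]) (by positivity)
      linarith
    · have q := hu2 1 o01
      have hq2 : 0 ≤ 2 * E1 1 - E1 1 ^ 2 := two_sub_sq_nonneg _ (pE1 1) (lE1 1 o01)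
      have q2 : B2 / ε ^ 2 * 1 ≤ B2 / ε ^ 2 * ((2 * E1 1 - E1 1 ^ 2) + (2 * E2 1 - E2 1 ^ 2)) := by
        refine mul_le_mul_of_nonneg_left ?_ (by positivity)
        rw [E21]; linarith
      have q3 : M / ε ^ 2 ≤ B2 / ε ^ 2 :=
        div_le_div_of_nonneg_right (by rw [hB2]; linarith [show 0 ≤ 4 * M * B ^ 2 / (3 * c ^ 2) by positivity]) (by positivity)
      linarith
  -- simplified bounds
  have hl0 : ∀ t, 0 ≤ layer c ε t / ε ^ 2 := fun t => by
    rw [hlay]; exact div_nonneg (by linarith [pE1 t, pE2 t]) (by positivity)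
  have t2 : ∀ t ∈ Icc (0:ℝ) 1, |u2 t| ≤ (A2 + 2 * B2) * (1 + layer c ε t / ε ^ 2) := by
    intro t ht
    have q : B2 / ε ^ 2 * ((2 * E1 t - E1 t ^ 2) + (2 * E2 t - E2 t ^ 2)) ≤
        B2 / ε ^ 2 * (2 * (E1 t + E2 t)) :=
      mul_le_mul_of_nonneg_left (by nlinarith [sq_nonneg (E1 t), sq_nonneg (E2 t)]) (by positivity)
    have e : B2 / ε ^ 2 * (2 * (E1 t + E2 t)) = 2 * B2 * (layer c ε t / ε ^ 2) := by
      rw [hlay]; ring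
    nlinarith [s3 t ht, hl0 t, mul_nonneg hA20.le (hl0 t)]
  have t4 : ∀ t ∈ Icc (0:ℝ) 1, |u4 t| ≤ K' / ε ^ 2 * (1 + layer c ε t / ε ^ 2) := by
    intro t ht
    have e : u4 t = (b t * u2 t + R t) / ε ^ 2 := by
      rw [← h4 t ht]; field_simp
    have q0 : |b t * u2 t + R t| ≤ M * |u2 t| + M * (1 + u1 t ^ 2) := by
      refine (abs_add_le _ _).trans (add_le_add ?_ (hR t ht))
      rw [abs_mul, abs_of_pos (hbpos t ht)]
      exact mul_le_mul_of_nonneg_right (hbM t ht) (abs_nonneg _)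
    have q1 : u1 t ^ 2 ≤ 2 * A ^ 2 + 4 * B ^ 2 * (layer c ε t / ε ^ 2) := by
      refine (s2' t ht).trans ?_
      have : 4 * B ^ 2 / ε ^ 2 * (E1 t ^ 2 + E2 t ^ 2) ≤ 4 * B ^ 2 / ε ^ 2 * (E1 t + E2 t) :=
        mul_le_mul_of_nonneg_left (by nlinarith [pE1 t, pE2 t, lE1 t ht, lE2 t ht]) (by positivity)
      have e : 4 * B ^ 2 / ε ^ 2 * (E1 t + E2 t) = 4 * B ^ 2 * (layer c ε t / ε ^ 2) := by
        rw [hlay]; ring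
      linarith
    have q2 := mul_le_mul_of_nonneg_left (t2 t ht) hM.le
    have q3 : |b t * u2 t + R t| ≤ K' * (1 + layer c ε t / ε ^ 2) := by
      set l := layer c ε t / ε ^ 2
      have hl := hl0 t
      have q4 := mul_le_mul_of_nonneg_left q1 hM.le
      have : K' * (1 + l) = (A2 + 2 * B2) * (1 + l) + M * ((A2 + 2 * B2) * (1 + l)) +
        M * (1 + 2 * A ^ 2 + 4 * B ^ 2 * l) + M * (4 * B ^ 2 + l + 2 * A ^ 2 * l) := by
          rw [hK']; ring
      have : 0 ≤ (A2 + 2 * B2) * (1 + l) := by positivity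
      have : 0 ≤ M * (4 * B ^ 2 + l + 2 * A ^ 2 * l) := by positivity
      linarith
    rw [e, abs_div, abs_of_pos (by positivity : (0:ℝ) < ε ^ 2), div_mul_eq_mul_div]
    exact div_le_div_of_nonneg_right q3 (by positivity)
  have hKK : A2 + 2 * B2 ≤ K' := by
    rw [hK']
    have : 0 ≤ (M * (A2 + 2 * B2) + M * (1 + 2 * A ^ 2 + 4 * B ^ 2)) := by positivity
    linarith
  have t2' : ∀ t ∈ Icc (0:ℝ) 1, |u2 t| ≤ K' * (1 + layer c ε t / ε ^ 2) := fun t ht =>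
    (t2 t ht).trans (mul_le_mul_of_nonneg_right hKK (by linarith [hl0 t]))
  have hmove : ∀ s t, |s - t| ≤ ε / 2 → layer c ε s ≤ κ * layer c ε t := by
    intro s t hst
    rw [abs_le] at hst
    rw [layer, layer, mul_add, hκ, ← Real.exp_add, ← Real.exp_add]
    apply add_le_add <;> apply Real.exp_le_exp.2
    · rw [div_add_div _ _ (by norm_num) hε0.ne', div_le_div_iff₀ hε0 (by positivity)]
      have : 0 ≤ (s - t + ε / 2) * (c * ε) := mul_nonneg (by linarith) (by positivity)
      nlinarith
    · rw [div_add_div _ _ (by norm_num) hε0.ne', div_le_div_iff₀ hε0 (by positivity)]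
      have : 0 ≤ (t - s + ε / 2) * (c * ε) := mul_nonneg (by linarith) (by positivity)
      nlinarith
  have hmove' : ∀ s t, |s - t| ≤ ε / 2 →
      1 + layer c ε s / ε ^ 2 ≤ κ * (1 + layer c ε t / ε ^ 2) := by
    intro s t hst
    have := div_le_div_of_nonneg_right (hmove s t hst) (sq_nonneg ε)
    rw [mul_div_assoc] at this
    linarith
  intro t ht
  have hfac : 0 ≤ 1 + layer c ε t / ε ^ 2 := by linarith [hl0 t]
  refine ⟨?_, ?_, ?_⟩
  · refine (t2' t ht).trans (mul_le_mul_of_nonneg_right ?_ hfac)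
    have : 0 ≤ 5 * K' * κ := by positivity
    linarith
  · have := interp_bound u2 u3 u4 ε t (K' * (κ * (1 + layer c ε t / ε ^ 2)))
      (K' / ε ^ 2 * (κ * (1 + layer c ε t / ε ^ 2))) hε0 hε1 ht d3 d4
      (fun s hs hst => (t2' s hs).trans (mul_le_mul_of_nonneg_left (hmove' s t hst) hK'0.le))
      (fun s hs hst => (t4 s hs).trans (mul_le_mul_of_nonneg_left (hmove' s t hst) (by positivity)))
    refine this.trans ?_
    have e : 4 * (K' * (κ * (1 + layer c ε t / ε ^ 2))) / ε +
      K' / ε ^ 2 * (κ * (1 + layer c ε t / ε ^ 2)) * ε / 2 =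
      (9 / 2 * K' * κ) / ε * (1 + layer c ε t / ε ^ 2) := by
        field_simp; ring
    rw [e]
    refine mul_le_mul_of_nonneg_right (div_le_div_of_nonneg_right ?_ hε0.le) hfac
    have : 0 ≤ K' * κ := by positivity
    linarith
  · refine (t4 t ht).trans (mul_le_mul_of_nonneg_right (div_le_div_of_nonneg_right ?_ (sq_nonneg ε)) hfac)
    have : 0 ≤ 5 * K' * κ := by positivity
    linarith

theorem partials (k : ℕ) (g : ℝ × ℝ → ℝ)
    (hg : ContDiffOn ℝ (k + 1) g ((Icc (0:ℝ) 1) ×ˢ (univ : Set ℝ))) :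
    ∃ gx gu : ℝ × ℝ → ℝ, ContDiffOn ℝ k gx ((Icc (0:ℝ) 1) ×ˢ (univ : Set ℝ)) ∧
      ContDiffOn ℝ k gu ((Icc (0:ℝ) 1) ×ˢ (univ : Set ℝ)) ∧
      (∀ x ∈ Icc (0:ℝ) 1, ∀ (v : ℝ → ℝ) (v' : ℝ), HasDerivWithinAt v v' (Icc 0 1) x →
        HasDerivWithinAt (fun t => g (t, v t)) (gx (x, v x) + gu (x, v x) * v') (Icc 0 1) x) ∧
      (∀ x ∈ Icc (0:ℝ) 1, ∀ y, HasDerivAt (fun z => g (x, z)) (gu (x, y)) y) := by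
  set S : Set (ℝ × ℝ) := (Icc (0:ℝ) 1) ×ˢ (univ : Set ℝ) with hS
  have hU : UniqueDiffOn ℝ S := (uniqueDiffOn_Icc zero_lt_one).prod uniqueDiffOn_univ
  have hD : ContDiffOn ℝ k (fderivWithin ℝ g S) S := hg.fderivWithin hU le_rfl
  have hdiff : ∀ p ∈ S, HasFDerivWithinAt g (fderivWithin ℝ g S p) S p := fun p hp =>
    ((hg p hp).differentiableWithinAt (by simp)).hasFDerivWithinAt
  refine ⟨fun p => fderivWithin ℝ g S p (1, 0), fun p => fderivWithin ℝ g S p (0, 1),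
    hD.clm_apply contDiffOn_const, hD.clm_apply contDiffOn_const, ?_, ?_⟩
  · intro x hx v v' hv
    have h1 : HasDerivWithinAt (fun t => (t, v t)) ((1:ℝ), v') (Icc 0 1) x :=
      (hasDerivWithinAt_id x _).prodMk hv
    have hm : MapsTo (fun t => (t, v t)) (Icc (0:ℝ) 1) S := fun t ht => ⟨ht, mem_univ _⟩
    have := (hdiff (x, v x) ⟨hx, mem_univ _⟩).comp_hasDerivWithinAt (f := fun t => (t, v t)) x h1 hm
    refine this.congr_deriv ?_
    have e : ((1:ℝ), v') = (1, 0) + v' • ((0:ℝ), (1:ℝ)) := by simp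
    rw [e, map_add, map_smul, smul_eq_mul, mul_comm v']
  · intro x hx y
    have h1 : HasDerivAt (fun z => (x, z)) ((0:ℝ), (1:ℝ)) y :=
      (hasDerivAt_const y x).prodMk (hasDerivAt_id y)
    exact (hdiff (x, y) ⟨hx, mem_univ _⟩).comp_hasDerivAt y h1
      (Filter.Eventually.of_forall fun t => ⟨hx, mem_univ _⟩)

theorem strong_mono (f : ℝ → ℝ → ℝ) (c₀ : ℝ) (hf : SmoothF f) (hfu : LowerF f c₀) :
    ∀ x ∈ Icc (0:ℝ) 1, Continuous (f x) ∧ ∀ a b, a ≤ b → c₀ ^ 2 * (b - a) ≤ f x b - f x a := by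
  obtain ⟨fx, fu, -, -, -, h⟩ := partials 3 (fun p => f p.1 p.2) (hf.of_le (by norm_num))
  intro x hx
  have hd : Differentiable ℝ (f x) := fun y => (h x hx y).differentiableAt
  exact ⟨hd.continuous, fun a b hab => mul_sub_le_image_sub_of_le_deriv hd (hfu x hx) hab⟩

theorem sol_derivs (f : ℝ → ℝ → ℝ) (hf : SmoothF f) (ε : ℝ) (hε : 0 < ε) (u : ℝ → ℝ)
    (hu : IsSolution f ε u) : ∃ u1 : ℝ → ℝ,
      (∀ t ∈ Icc (0:ℝ) 1, HasDerivWithinAt u (u1 t) (Icc 0 1) t) ∧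
      (∀ t ∈ Icc (0:ℝ) 1, HasDerivWithinAt u1 (f t (u t) / ε ^ 2) (Icc 0 1) t) := by
  obtain ⟨hc, heq, -, -⟩ := hu
  have hU := uniqueDiffOn_Icc (zero_lt_one (α := ℝ))
  have c1 : ContDiffOn ℝ 3 (derivWithin u (Icc 0 1)) (Icc 0 1) :=
    hc.derivWithin hU (by norm_num)
  have c2 : ContDiffOn ℝ 2 (derivWithin (derivWithin u (Icc 0 1)) (Icc 0 1)) (Icc 0 1) :=
    c1.derivWithin hU (by norm_num)
  have hFc : ContinuousOn (fun t => f t (u t) / ε ^ 2) (Icc 0 1) := by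
    refine ContinuousOn.div_const ?_ _
    exact hf.continuousOn.comp (f := fun t => (t, u t)) (continuousOn_id.prodMk hc.continuousOn)
      (fun t ht => ⟨ht, mem_univ _⟩)
  have hE : EqOn (derivWithin (derivWithin u (Icc 0 1)) (Icc 0 1)) (fun t => f t (u t) / ε ^ 2)
      (Ioo 0 1) := by
    intro t ht
    have h := heq t ht
    have e : iteratedDerivWithin 2 u (Icc (0:ℝ) 1) t =
        derivWithin (derivWithin u (Icc 0 1)) (Icc 0 1) t := by
      rw [iteratedDerivWithin_succ, iteratedDerivWithin_one]
    rw [e] at h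
    show _ = f t (u t) / ε ^ 2
    rw [eq_div_iff (by positivity)]
    linarith
  have hE' := hE.of_subset_closure c2.continuousOn hFc Ioo_subset_Icc_self
    (by rw [closure_Ioo (by norm_num)])
  refine ⟨derivWithin u (Icc 0 1), fun t ht => ?_, fun t ht => ?_⟩
  · exact (hc.differentiableOn (by norm_num) t ht).hasDerivWithinAt
  · have := (c1.differentiableOn (by norm_num) t ht).hasDerivWithinAt
    exact this.congr_deriv (hE' ht)

theorem regularity (f : ℝ → ℝ → ℝ) (c₀ : ℝ) (hc₀ : 0 < c₀)
    (hf : SmoothF f) (hfu : LowerF f c₀) :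
    ∃ K : ℝ, 0 < K ∧ ∀ ε ∈ Ioc (0:ℝ) 1, ∀ u : ℝ → ℝ, IsSolution f ε u →
      ∃ u1 u2 u3 u4 : ℝ → ℝ,
      (∀ t ∈ Icc (0:ℝ) 1, HasDerivWithinAt u (u1 t) (Icc 0 1) t) ∧
      (∀ t ∈ Icc (0:ℝ) 1, HasDerivWithinAt u1 (u2 t) (Icc 0 1) t) ∧
      (∀ t ∈ Icc (0:ℝ) 1, HasDerivWithinAt u2 (u3 t) (Icc 0 1) t) ∧
      (∀ t ∈ Icc (0:ℝ) 1, HasDerivWithinAt u3 (u4 t) (Icc 0 1) t) ∧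
      (∀ t ∈ Icc (0:ℝ) 1, f t (u t) = ε ^ 2 * u2 t) ∧
      ∀ t ∈ Icc (0:ℝ) 1,
        |u2 t| ≤ K * (1 + layer c₀ ε t / ε ^ 2) ∧
        |u3 t| ≤ K / ε * (1 + layer c₀ ε t / ε ^ 2) ∧
        |u4 t| ≤ K / ε ^ 2 * (1 + layer c₀ ε t / ε ^ 2) := by
  have hc2 : 0 < c₀ ^ 2 := by positivity
  have hsm := strong_mono f c₀ hf hfu
  obtain ⟨fx, fu, cfx, cfu, chf, vf⟩ := partials 3 (fun p => f p.1 p.2) (hf.of_le (by norm_num))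
  obtain ⟨fxx, fxu, cfxx, cfxu, chfx, -⟩ := partials 2 fx (cfx.of_le (by norm_num))
  obtain ⟨fux, fuu, cfux, cfuu, chfu, -⟩ := partials 2 fu (cfu.of_le (by norm_num))
  -- bound on f(x,0)
  obtain ⟨L0, hL0⟩ := (isCompact_Icc (a := (0:ℝ)) (b := 1)).exists_bound_of_continuousOn
    (f := fun t => f t 0) (hf.continuousOn.comp (f := fun t => (t, (0:ℝ)))
      (by fun_prop) (fun t ht => ⟨ht, mem_univ _⟩))
  have hL00 : 0 ≤ L0 := (norm_nonneg _).trans (hL0 0 (by simp))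
  set L : ℝ := L0 / c₀ ^ 2 with hL
  have hLn : 0 ≤ L := by positivity
  have hLc : c₀ ^ 2 * L = L0 := by rw [hL]; field_simp
  have hbd : ∀ g : ℝ × ℝ → ℝ, ContinuousOn g ((Icc (0:ℝ) 1) ×ˢ (univ : Set ℝ)) →
      ∃ m, 0 ≤ m ∧ ∀ t ∈ Icc (0:ℝ) 1, ∀ y, |y| ≤ L → |g (t, y)| ≤ m := by
    intro g hg
    obtain ⟨m, hm⟩ := ((isCompact_Icc (a := (0:ℝ)) (b := 1)).prod
      (isCompact_Icc (a := -L) (b := L))).exists_bound_of_continuousOn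
      (hg.mono (prod_mono_right (subset_univ _)))
    refine ⟨m, (norm_nonneg _).trans (hm (0, 0) ⟨by simp, by simp [hLn]⟩), fun t ht y hy => ?_⟩
    exact hm (t, y) ⟨ht, abs_le.1 hy⟩
  obtain ⟨m1, p1, b1⟩ := hbd _ hf.continuousOn
  obtain ⟨m2, p2, b2⟩ := hbd _ cfx.continuousOn
  obtain ⟨m3, p3, b3⟩ := hbd _ cfu.continuousOn
  obtain ⟨m4, p4, b4⟩ := hbd _ cfxx.continuousOn
  obtain ⟨m5, p5, b5⟩ := hbd _ cfxu.continuousOn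
  obtain ⟨m6, p6, b6⟩ := hbd _ cfux.continuousOn
  obtain ⟨m7, p7, b7⟩ := hbd _ cfuu.continuousOn
  obtain ⟨K, hK, H⟩ := reg_abs c₀ (1 + m1 + m2 + m3 + m4 + m5 + m6 + m7) L hc₀ (by positivity) hLn
  refine ⟨K, hK, fun ε hε u hu => ?_⟩
  have hεne : ε ≠ 0 := hε.1.ne'
  have hε2 : 0 < ε ^ 2 := by have := hε.1; positivity
  obtain ⟨u1, d1, d2⟩ := sol_derivs f hf ε hε.1 u hu
  have hd1 : ∀ t ∈ Ioo (0:ℝ) 1, HasDerivAt u (u1 t) t := fun t ht =>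
    (d1 t (Ioo_subset_Icc_self ht)).hasDerivAt (Icc_mem_nhds ht.1 ht.2)
  have hd2 : ∀ t ∈ Ioo (0:ℝ) 1, HasDerivAt u1 (f t (u t) / ε ^ 2) t := fun t ht =>
    (d2 t (Ioo_subset_Icc_self ht)).hasDerivAt (Icc_mem_nhds ht.1 ht.2)
  have huc : ContinuousOn u (Icc 0 1) := fun t ht => (d1 t ht).continuousWithinAt
  have uL : ∀ t ∈ Icc (0:ℝ) 1, |u t| ≤ L := by
    have A1 := cont_min_principle (fun t => L - u t) (fun t => -u1 t)
      (fun t => -(f t (u t) / ε ^ 2)) (continuousOn_const.sub huc)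
      (fun t ht => (hd1 t ht).const_sub L) (fun t ht => (hd2 t ht).neg)
      (fun t ht hneg => by
        have htI := Ioo_subset_Icc_self ht
        have q := (hsm t htI).2 0 (u t) (by linarith)
        have q2 := (abs_le.1 (hL0 t htI)).1
        have q3 : 0 < c₀ ^ 2 * (u t - L) := mul_pos hc2 (by linarith)
        have : 0 < f t (u t) / ε ^ 2 := div_pos (by linarith) hε2
        linarith) (by simp [hu.2.2.1, hLn]) (by simp [hu.2.2.2, hLn])
    have A2 := cont_min_principle (fun t => u t + L) (fun t => u1 t)
      (fun t => f t (u t) / ε ^ 2) (huc.add continuousOn_const)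
      (fun t ht => (hd1 t ht).add_const L) (fun t ht => (hd2 t ht))
      (fun t ht hneg => by
        have htI := Ioo_subset_Icc_self ht
        have q := (hsm t htI).2 (u t) 0 (by linarith)
        have q2 := (abs_le.1 (hL0 t htI)).2
        have q3 : 0 < c₀ ^ 2 * (0 - u t - L) := mul_pos hc2 (by linarith)
        exact div_neg_of_neg_of_pos (by linarith) hε2) (by simp [hu.2.2.1, hLn])
        (by simp [hu.2.2.2, hLn])
    intro t ht
    rw [abs_le]
    exact ⟨by linarith [A2 t ht], by linarith [A1 t ht]⟩
  set u3 : ℝ → ℝ := fun t => (fx (t, u t) + fu (t, u t) * u1 t) / ε ^ 2 with hu3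
  set R : ℝ → ℝ := fun t => fxx (t, u t) + fxu (t, u t) * u1 t +
    (fux (t, u t) + fuu (t, u t) * u1 t) * u1 t with hR
  set u4 : ℝ → ℝ := fun t => (fu (t, u t) * (f t (u t) / ε ^ 2) + R t) / ε ^ 2 with hu4
  have d3 : ∀ t ∈ Icc (0:ℝ) 1, HasDerivWithinAt (fun t => f t (u t) / ε ^ 2) (u3 t) (Icc 0 1) t :=
    fun t ht => (chf t ht u _ (d1 t ht)).div_const _
  have d4 : ∀ t ∈ Icc (0:ℝ) 1, HasDerivWithinAt u3 (u4 t) (Icc 0 1) t := fun t ht => by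
    have := ((chfx t ht u _ (d1 t ht)).add ((chfu t ht u _ (d1 t ht)).mul (d2 t ht))).div_const (ε ^ 2)
    refine this.congr_deriv ?_
    simp only [hu4, hR]; ring
  refine ⟨u1, fun t => f t (u t) / ε ^ 2, u3, u4, d1, d2, d3, d4,
    fun t ht => by field_simp, ?_⟩
  refine H ε hε u u1 _ u3 u4 (fun t => fx (t, u t)) (fun t => fu (t, u t)) R d1 d2 d3 d4 uL
    ?_ ?_ ?_ ?_ ?_ ?_ ?_
  · intro t ht
    have := b1 t ht _ (uL t ht)
    rw [abs_div, abs_of_pos hε2]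
    exact div_le_div_of_nonneg_right (by linarith) hε2.le
  · intro t ht
    simp only [hu3]; field_simp; ring
  · intro t ht
    simp only [hu4]; field_simp
  · intro t ht
    have := b2 t ht _ (uL t ht)
    linarith
  · intro t ht
    rw [← (vf t ht (u t)).deriv]
    exact hfu t ht (u t)
  · intro t ht
    have := (abs_le.1 (b3 t ht _ (uL t ht))).2
    linarith
  · intro t ht
    have q4 := b4 t ht _ (uL t ht)
    have q5 := b5 t ht _ (uL t ht)
    have q6 := b6 t ht _ (uL t ht)
    have q7 := b7 t ht _ (uL t ht)
    have hv : |u1 t| ≤ 1 + u1 t ^ 2 := by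
      rw [← sq_abs]; nlinarith [sq_nonneg (|u1 t| - 1), abs_nonneg (u1 t)]
    have r1 : |fxu (t, u t) * u1 t| ≤ m5 * (1 + u1 t ^ 2) := by
      rw [abs_mul]; exact mul_le_mul q5 hv (abs_nonneg _) p5
    have r2 : |fux (t, u t) * u1 t| ≤ m6 * (1 + u1 t ^ 2) := by
      rw [abs_mul]; exact mul_le_mul q6 hv (abs_nonneg _) p6
    have r3 : |fuu (t, u t) * u1 t ^ 2| ≤ m7 * (1 + u1 t ^ 2) := by
      rw [abs_mul, abs_of_nonneg (sq_nonneg (u1 t))]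
      exact mul_le_mul q7 (by linarith) (sq_nonneg _) p7
    have r0 : |fxx (t, u t)| ≤ m4 * (1 + u1 t ^ 2) := by
      nlinarith [mul_nonneg p4 (sq_nonneg (u1 t))]
    have e : R t = fxx (t, u t) + fxu (t, u t) * u1 t + fux (t, u t) * u1 t +
      fuu (t, u t) * u1 t ^ 2 := by simp only [hR]; ring
    rw [e]
    have z1 := abs_add_le (fxx (t, u t) + fxu (t, u t) * u1 t + fux (t, u t) * u1 t)
      (fuu (t, u t) * u1 t ^ 2)
    have z2 := abs_add_le (fxx (t, u t) + fxu (t, u t) * u1 t) (fux (t, u t) * u1 t)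
    have z3 := abs_add_le (fxx (t, u t)) (fxu (t, u t) * u1 t)
    have z4 : 0 ≤ (1 + m1 + m2 + m3) * (1 + u1 t ^ 2) := by positivity
    linarith

theorem ddiff_add (x a b : ℕ → ℝ) (i : ℕ) :
    ddiff x (fun j => a j + b j) i = ddiff x a i + ddiff x b i := by
  unfold ddiff; ring

theorem ddiff_sub (x a b : ℕ → ℝ) (i : ℕ) :
    ddiff x (fun j => a j - b j) i = ddiff x a i - ddiff x b i := by
  unfold ddiff; ring

theorem ddiff_affine (x b : ℕ → ℝ) (A B : ℝ) (i : ℕ) :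
    ddiff x (fun j => A + B * b j) i = B * ddiff x b i := by
  unfold ddiff; ring

theorem error_lemma (f : ℝ → ℝ → ℝ) (c₀ ε : ℝ) (x : ℕ → ℝ) (n : ℕ) (U y ψ w : ℕ → ℝ)
    (hc₀ : 0 < c₀) (hx : ∀ i < n, x i < x (i + 1))
    (hsm : ∀ i ≤ n, ∀ a b, a ≤ b → c₀ ^ 2 * (b - a) ≤ f (x i) b - f (x i) a)
    (hU : ∀ i ≤ n, f (x i) (U i) = ε ^ 2 * w i) (hU0 : U 0 = 0) (hUn : U n = 0)
    (hy : NonlinScheme f ε x n y) (hψ : ∀ i ≤ n, 0 ≤ ψ i)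
    (hτ : ∀ i, 1 ≤ i → i < n →
      ε ^ 2 * |ddiff x U i - w i| ≤ -ε ^ 2 * ddiff x ψ i + c₀ ^ 2 * ψ i) :
    ∀ i ≤ n, |U i - y i| ≤ ψ i := by
  have hf : ∀ i ≤ n, ∀ a b, a < b → f (x i) a < f (x i) b := fun i hi a b hab => by
    have := hsm i hi a b hab.le
    have : 0 < c₀ ^ 2 * (b - a) := mul_pos (by positivity) (by linarith)
    linarith
  obtain ⟨hy1, hy0, hyn⟩ := hy
  have h1 := disc_comparison f ε x n (fun j => U j + ψ j) y hx hf (fun i h1 hi => by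
    rw [hy1 i h1 hi, ddiff_add]
    have a1 := hsm i hi.le (U i) (U i + ψ i) (by linarith [hψ i hi.le])
    have a2 := hU i hi.le
    have a3 := hτ i h1 hi
    have a4 := mul_le_mul_of_nonneg_left (le_abs_self (ddiff x U i - w i)) (sq_nonneg ε)
    nlinarith) (by linarith [hψ 0 (Nat.zero_le _)])
    (by linarith [hψ n le_rfl])
  have h2 := disc_comparison f ε x n y (fun j => U j - ψ j) hx hf (fun i h1 hi => by
    rw [hy1 i h1 hi, ddiff_sub]
    have a1 := hsm i hi.le (U i - ψ i) (U i) (by linarith [hψ i hi.le])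
    have a2 := hU i hi.le
    have a3 := hτ i h1 hi
    have a4 := mul_le_mul_of_nonneg_left (neg_abs_le (ddiff x U i - w i)) (sq_nonneg ε)
    nlinarith) (by linarith [hψ 0 (Nat.zero_le _)])
    (by linarith [hψ n le_rfl])
  intro i hi
  have := h1 i hi
  have := h2 i hi
  rw [abs_le]; constructor <;> linarith

/-- pulling a derivative back along `s ↦ x + σ s`. -/
theorem shift_deriv (v v' : ℝ → ℝ) (x σ h : ℝ)
    (hI : ∀ s ∈ Icc 0 h, x + σ * s ∈ Icc (0:ℝ) 1)
    (hv : ∀ t ∈ Icc (0:ℝ) 1, HasDerivWithinAt v (v' t) (Icc 0 1) t) :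
    ∀ s ∈ Icc 0 h, HasDerivWithinAt (fun s => v (x + σ * s)) (v' (x + σ * s) * σ) (Icc 0 h) s := by
  intro s hs
  have h1 : HasDerivWithinAt (fun s => x + σ * s) σ (Icc 0 h) s := by
    simpa using ((hasDerivWithinAt_id s (Icc 0 h)).const_mul σ).const_add x
  exact (hv _ (hI s hs)).comp (h₂ := v) s h1 (fun t ht => hI t ht)

section side
variable (u u1 u2 u3 u4 : ℝ → ℝ) (x σ h : ℝ)

theorem side_0 (d1 : ∀ t ∈ Icc (0:ℝ) 1, HasDerivWithinAt u (u1 t) (Icc 0 1) t)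
    (d2 : ∀ t ∈ Icc (0:ℝ) 1, HasDerivWithinAt u1 (u2 t) (Icc 0 1) t)
    (hσ : σ ^ 2 = 1) (hh : 0 ≤ h) (hI : ∀ s ∈ Icc 0 h, x + σ * s ∈ Icc (0:ℝ) 1)
    (M : ℝ) (hM : ∀ s ∈ Icc 0 h, |u2 (x + σ * s)| ≤ M) :
    |u (x + σ * h) - u x - h * (u1 x * σ) - h ^ 2 / 2 * u2 x| ≤ 2 * M * h ^ 2 := by
  have h0 : (0:ℝ) ∈ Icc 0 h := ⟨le_rfl, hh⟩
  have hM0 : 0 ≤ M := (abs_nonneg _).trans (hM 0 h0)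
  have := taylor_A (fun s => u (x + σ * s)) (fun s => u1 (x + σ * s) * σ)
    (fun s => u2 (x + σ * s)) h (2 * M) hh (shift_deriv u u1 x σ h hI d1)
    (fun s hs => ((shift_deriv u1 u2 x σ h hI d2 s hs).mul_const σ).congr_deriv (by
      rw [mul_assoc, ← sq, hσ, mul_one])) 0 (by linarith) (fun s hs => by
        have q1 := hM s hs
        have q2 := hM 0 h0
        have := abs_sub (u2 (x + σ * s)) (u2 (x + σ * 0))
        simp only [pow_zero, mul_one]
        linarith)
  simpa using this

theorem side_1 (d1 : ∀ t ∈ Icc (0:ℝ) 1, HasDerivWithinAt u (u1 t) (Icc 0 1) t)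
    (d2 : ∀ t ∈ Icc (0:ℝ) 1, HasDerivWithinAt u1 (u2 t) (Icc 0 1) t)
    (d3 : ∀ t ∈ Icc (0:ℝ) 1, HasDerivWithinAt u2 (u3 t) (Icc 0 1) t)
    (hσ : σ ^ 2 = 1) (hh : 0 ≤ h) (hI : ∀ s ∈ Icc 0 h, x + σ * s ∈ Icc (0:ℝ) 1)
    (T : ℝ) (hT : ∀ s ∈ Icc 0 h, |u3 (x + σ * s)| ≤ T) :
    |u (x + σ * h) - u x - h * (u1 x * σ) - h ^ 2 / 2 * u2 x| ≤ T * h ^ 3 := by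
  have h0 : (0:ℝ) ∈ Icc 0 h := ⟨le_rfl, hh⟩
  have hT0 : 0 ≤ T := (abs_nonneg _).trans (hT 0 h0)
  have hσ1 : |σ| = 1 := by
    have := sq_abs σ
    nlinarith [abs_nonneg σ]
  have := taylor_A (fun s => u (x + σ * s)) (fun s => u1 (x + σ * s) * σ)
    (fun s => u2 (x + σ * s)) h T hh (shift_deriv u u1 x σ h hI d1)
    (fun s hs => ((shift_deriv u1 u2 x σ h hI d2 s hs).mul_const σ).congr_deriv (by
      rw [mul_assoc, ← sq, hσ, mul_one])) 1 hT0 (fun s hs => by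
        have := (convex_Icc (0:ℝ) h).norm_image_sub_le_of_norm_hasDerivWithin_le (C := T)
          (shift_deriv u2 u3 x σ h hI d3) (fun t ht => by
            rw [Real.norm_eq_abs, abs_mul, hσ1, mul_one]; exact hT t ht) h0 hs
        simpa [Real.norm_eq_abs, abs_of_nonneg hs.1] using this)
  simpa using this

theorem side_2 (d1 : ∀ t ∈ Icc (0:ℝ) 1, HasDerivWithinAt u (u1 t) (Icc 0 1) t)
    (d2 : ∀ t ∈ Icc (0:ℝ) 1, HasDerivWithinAt u1 (u2 t) (Icc 0 1) t)
    (d3 : ∀ t ∈ Icc (0:ℝ) 1, HasDerivWithinAt u2 (u3 t) (Icc 0 1) t)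
    (d4 : ∀ t ∈ Icc (0:ℝ) 1, HasDerivWithinAt u3 (u4 t) (Icc 0 1) t)
    (hσ : σ ^ 2 = 1) (hh : 0 ≤ h) (hI : ∀ s ∈ Icc 0 h, x + σ * s ∈ Icc (0:ℝ) 1)
    (Q : ℝ) (hQ : ∀ s ∈ Icc 0 h, |u4 (x + σ * s)| ≤ Q) :
    |u (x + σ * h) - u x - h * (u1 x * σ) - h ^ 2 / 2 * u2 x - h ^ 3 / 6 * (u3 x * σ)|
      ≤ Q * h ^ 4 := by
  have h0 : (0:ℝ) ∈ Icc 0 h := ⟨le_rfl, hh⟩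
  have hQ0 : 0 ≤ Q := (abs_nonneg _).trans (hQ 0 h0)
  have := taylor_C (fun s => u (x + σ * s)) (fun s => u1 (x + σ * s) * σ)
    (fun s => u2 (x + σ * s)) (fun s => u3 (x + σ * s) * σ) (fun s => u4 (x + σ * s)) h Q hh hQ0
    (shift_deriv u u1 x σ h hI d1)
    (fun s hs => ((shift_deriv u1 u2 x σ h hI d2 s hs).mul_const σ).congr_deriv (by
      rw [mul_assoc, ← sq, hσ, mul_one]))
    (shift_deriv u2 u3 x σ h hI d3)
    (fun s hs => ((shift_deriv u3 u4 x σ h hI d4 s hs).mul_const σ).congr_deriv (by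
      rw [mul_assoc, ← sq, hσ, mul_one])) hQ
  simpa using this

end side

/-- truncation error from one-sided remainders. -/
theorem trunc_sides (up u0 um a b h k B : ℝ) (hh : 0 < h) (hk : 0 < k)
    (h1 : |up - u0 - k * (a * 1) - k ^ 2 / 2 * b| ≤ B * k ^ 2)
    (h2 : |um - u0 - h * (a * (-1)) - h ^ 2 / 2 * b| ≤ B * h ^ 2) :
    |2 / (k + h) * ((up - u0) / k - (u0 - um) / h) - b| ≤ 2 * B := by
  set r := up - u0 - k * (a * 1) - k ^ 2 / 2 * b with hr
  set q := um - u0 - h * (a * (-1)) - h ^ 2 / 2 * b with hq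
  have e : 2 / (k + h) * ((up - u0) / k - (u0 - um) / h) - b = 2 / (k + h) * (r / k + q / h) := by
    have : k + h ≠ 0 := by positivity
    rw [hr, hq]; field_simp; ring
  rw [e, abs_mul, abs_of_pos (by positivity : 0 < 2 / (k + h))]
  have a1 : |r / k| ≤ B * k := by
    rw [abs_div, abs_of_pos hk, div_le_iff₀ hk]; linarith
  have a2 : |q / h| ≤ B * h := by
    rw [abs_div, abs_of_pos hh, div_le_iff₀ hh]; linarith
  calc 2 / (k + h) * |r / k + q / h| ≤ 2 / (k + h) * (B * k + B * h) := by
        apply mul_le_mul_of_nonneg_left _ (by positivity)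
        linarith [abs_add_le (r / k) (q / h)]
    _ = 2 * B := by field_simp

theorem trunc_unif (up u0 um a b c h Q : ℝ) (hh : 0 < h)
    (h1 : |up - u0 - h * (a * 1) - h ^ 2 / 2 * b - h ^ 3 / 6 * (c * 1)| ≤ Q * h ^ 4)
    (h2 : |um - u0 - h * (a * (-1)) - h ^ 2 / 2 * b - h ^ 3 / 6 * (c * (-1))| ≤ Q * h ^ 4) :
    |2 / (h + h) * ((up - u0) / h - (u0 - um) / h) - b| ≤ 2 * Q * h ^ 2 := by
  set r := up - u0 - h * (a * 1) - h ^ 2 / 2 * b - h ^ 3 / 6 * (c * 1) with hr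
  set q := um - u0 - h * (a * (-1)) - h ^ 2 / 2 * b - h ^ 3 / 6 * (c * (-1)) with hq
  have e : 2 / (h + h) * ((up - u0) / h - (u0 - um) / h) - b = (r + q) / h ^ 2 := by
    rw [hr, hq]; field_simp; ring
  rw [e, abs_div, abs_of_pos (by positivity : 0 < h ^ 2), div_le_iff₀ (by positivity)]
  nlinarith [abs_add_le r q]

theorem ddiff_form (x y : ℕ → ℝ) (i : ℕ) (h k : ℝ) (hp : x (i + 1) = x i + k)
    (hm : x (i - 1) = x i - h) :
    ddiff x y i = 2 / (k + h) * ((y (i + 1) - y i) / k - (y i - y (i - 1)) / h) := by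
  unfold ddiff
  rw [hp, hm]
  congr 2 <;> ring_nf

section claims
variable (u u1 u2 u3 u4 : ℝ → ℝ) (x : ℕ → ℝ) (i : ℕ) (h k K ε E : ℝ)

theorem claim_unif (d1 : ∀ t ∈ Icc (0:ℝ) 1, HasDerivWithinAt u (u1 t) (Icc 0 1) t)
    (d2 : ∀ t ∈ Icc (0:ℝ) 1, HasDerivWithinAt u1 (u2 t) (Icc 0 1) t)
    (d3 : ∀ t ∈ Icc (0:ℝ) 1, HasDerivWithinAt u2 (u3 t) (Icc 0 1) t)
    (d4 : ∀ t ∈ Icc (0:ℝ) 1, HasDerivWithinAt u3 (u4 t) (Icc 0 1) t)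
    (hp : x (i + 1) = x i + h) (hm : x (i - 1) = x i - h) (hh : 0 < h)
    (h0 : 0 ≤ x i - h) (h1 : x i + h ≤ 1) (Q : ℝ)
    (hQ : ∀ t ∈ Icc (x i - h) (x i + h), |u4 t| ≤ Q) :
    |ddiff x (fun j => u (x j)) i - u2 (x i)| ≤ 2 * Q * h ^ 2 := by
  rw [ddiff_form x _ i h h hp hm, hp, hm]
  have a := side_2 u u1 u2 u3 u4 (x i) 1 h d1 d2 d3 d4 (by norm_num) hh.le
    (fun s hs => ⟨by linarith [hs.1], by linarith [hs.2]⟩) Q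
    (fun s hs => hQ _ ⟨by linarith [hs.1], by linarith [hs.2]⟩)
  have b := side_2 u u1 u2 u3 u4 (x i) (-1) h d1 d2 d3 d4 (by norm_num) hh.le
    (fun s hs => ⟨by linarith [hs.2], by linarith [hs.1]⟩) Q
    (fun s hs => hQ _ ⟨by linarith [hs.2], by linarith [hs.1]⟩)
  rw [show x i + 1 * h = x i + h by ring] at a
  rw [show x i + -1 * h = x i - h by ring] at b
  exact trunc_unif _ _ _ _ _ _ _ _ hh a b

theorem claim_coarse (d1 : ∀ t ∈ Icc (0:ℝ) 1, HasDerivWithinAt u (u1 t) (Icc 0 1) t)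
    (d2 : ∀ t ∈ Icc (0:ℝ) 1, HasDerivWithinAt u1 (u2 t) (Icc 0 1) t)
    (d3 : ∀ t ∈ Icc (0:ℝ) 1, HasDerivWithinAt u2 (u3 t) (Icc 0 1) t)
    (d4 : ∀ t ∈ Icc (0:ℝ) 1, HasDerivWithinAt u3 (u4 t) (Icc 0 1) t)
    (hp : x (i + 1) = x i + h) (hm : x (i - 1) = x i - h) (hh : 0 < h)
    (h0 : 0 ≤ x i - h) (h1 : x i + h ≤ 1) (hε : 0 < ε) (hK : 0 < K) (hE : 0 ≤ E)
    (b2 : ∀ t ∈ Icc (x i - h) (x i + h), |u2 t| ≤ K * (1 + E / ε ^ 2))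
    (b4 : ∀ t ∈ Icc (x i - h) (x i + h), |u4 t| ≤ K / ε ^ 2 * (1 + E / ε ^ 2)) :
    ε ^ 2 * |ddiff x (fun j => u (x j)) i - u2 (x i)| ≤ 4 * K * (h ^ 2 + E) := by
  have hε2 : 0 < ε ^ 2 := by positivity
  rcases le_or_gt h ε with hle | hlt
  · have := claim_unif u u1 u2 u3 u4 x i h d1 d2 d3 d4 hp hm hh h0 h1 _ b4
    have q : h ^ 2 / ε ^ 2 ≤ 1 := by
      rw [div_le_one hε2]; exact pow_le_pow_left₀ hh.le hle 2
    calc ε ^ 2 * |ddiff x (fun j => u (x j)) i - u2 (x i)|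
        ≤ ε ^ 2 * (2 * (K / ε ^ 2 * (1 + E / ε ^ 2)) * h ^ 2) :=
          mul_le_mul_of_nonneg_left this hε2.le
      _ = 2 * K * (h ^ 2 + E * (h ^ 2 / ε ^ 2)) := by field_simp
      _ ≤ 2 * K * (h ^ 2 + E * 1) := by gcongr
      _ ≤ 4 * K * (h ^ 2 + E) := by nlinarith [mul_nonneg hK.le (by positivity : 0 ≤ h ^ 2 + E)]
  · have a := side_0 u u1 u2 (x i) 1 h d1 d2 (by norm_num) hh.le
      (fun s hs => ⟨by linarith [hs.1], by linarith [hs.2]⟩) _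
      (fun s hs => b2 _ ⟨by linarith [hs.1], by linarith [hs.2]⟩)
    have b := side_0 u u1 u2 (x i) (-1) h d1 d2 (by norm_num) hh.le
      (fun s hs => ⟨by linarith [hs.2], by linarith [hs.1]⟩) _
      (fun s hs => b2 _ ⟨by linarith [hs.2], by linarith [hs.1]⟩)
    rw [show x i + 1 * h = x i + h by ring] at a
    rw [show x i + -1 * h = x i - h by ring] at b
    have := trunc_sides _ _ _ _ _ _ _ _ hh hh a b
    rw [ddiff_form x _ i h h hp hm, hp, hm]
    have q : ε ^ 2 ≤ h ^ 2 := pow_le_pow_left₀ hε.le hlt.le 2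
    calc _ ≤ ε ^ 2 * (2 * (2 * (K * (1 + E / ε ^ 2)))) :=
          mul_le_mul_of_nonneg_left this hε2.le
      _ = 4 * K * (ε ^ 2 + E) := by field_simp; ring
      _ ≤ 4 * K * (h ^ 2 + E) := by gcongr

theorem side_B (X σ s S : ℝ) (d1 : ∀ t ∈ Icc (0:ℝ) 1, HasDerivWithinAt u (u1 t) (Icc 0 1) t)
    (d2 : ∀ t ∈ Icc (0:ℝ) 1, HasDerivWithinAt u1 (u2 t) (Icc 0 1) t)
    (d3 : ∀ t ∈ Icc (0:ℝ) 1, HasDerivWithinAt u2 (u3 t) (Icc 0 1) t)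
    (hσ : σ ^ 2 = 1) (hs : 0 < s) (hsS : s ≤ S)
    (hI : ∀ r ∈ Icc 0 s, X + σ * r ∈ Icc (0:ℝ) 1)
    (hε : 0 < ε) (hK : 0 < K) (hE : 0 ≤ E)
    (b2 : ∀ r ∈ Icc 0 s, |u2 (X + σ * r)| ≤ K * (1 + E / ε ^ 2))
    (b3 : ∀ r ∈ Icc 0 s, |u3 (X + σ * r)| ≤ K / ε * (1 + E / ε ^ 2)) :
    |u (X + σ * s) - u X - s * (u1 X * σ) - s ^ 2 / 2 * u2 X|
      ≤ 2 * K * (S / ε + E / ε ^ 2) * s ^ 2 := by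
  have hE2 : 0 ≤ E / ε ^ 2 := by positivity
  have hS : 0 < S := by linarith
  rcases le_or_gt s ε with hle | hlt
  · refine (side_1 u u1 u2 u3 X σ s d1 d2 d3 hσ hs.le hI _ b3).trans ?_
    have q : s / ε ≤ 1 := by rwa [div_le_one hε]
    have q2 : s / ε ≤ S / ε := by gcongr
    calc K / ε * (1 + E / ε ^ 2) * s ^ 3 = K * (s / ε + E / ε ^ 2 * (s / ε)) * s ^ 2 := by
          field_simp
      _ ≤ K * (S / ε + E / ε ^ 2 * 1) * s ^ 2 := by gcongr
      _ ≤ _ := by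
        have : 0 ≤ K * (S / ε + E / ε ^ 2) * s ^ 2 := by positivity
        linarith
  · refine (side_0 u u1 u2 X σ s d1 d2 hσ hs.le hI _ b2).trans ?_
    have q : 1 ≤ S / ε := by rw [le_div_iff₀ hε]; linarith
    rw [← mul_assoc]
    gcongr

theorem claim_trans (S : ℝ) (d1 : ∀ t ∈ Icc (0:ℝ) 1, HasDerivWithinAt u (u1 t) (Icc 0 1) t)
    (d2 : ∀ t ∈ Icc (0:ℝ) 1, HasDerivWithinAt u1 (u2 t) (Icc 0 1) t)
    (d3 : ∀ t ∈ Icc (0:ℝ) 1, HasDerivWithinAt u2 (u3 t) (Icc 0 1) t)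
    (hp : x (i + 1) = x i + k) (hm : x (i - 1) = x i - h) (hh : 0 < h) (hk : 0 < k)
    (hhS : h ≤ S) (hkS : k ≤ S)
    (h0 : 0 ≤ x i - h) (h1 : x i + k ≤ 1) (hε : 0 < ε) (hK : 0 < K) (hE : 0 ≤ E)
    (b2 : ∀ t ∈ Icc (x i - h) (x i + k), |u2 t| ≤ K * (1 + E / ε ^ 2))
    (b3 : ∀ t ∈ Icc (x i - h) (x i + k), |u3 t| ≤ K / ε * (1 + E / ε ^ 2)) :
    ε ^ 2 * |ddiff x (fun j => u (x j)) i - u2 (x i)| ≤ 4 * K * (ε * S + E) := by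
  have hε2 : 0 < ε ^ 2 := by positivity
  have a := side_B u u1 u2 u3 K ε E (x i) 1 k S d1 d2 d3 (by norm_num) hk hkS
    (fun s hs => ⟨by linarith [hs.1], by linarith [hs.2]⟩) hε hK hE
    (fun s hs => b2 _ ⟨by linarith [hs.1], by linarith [hs.2]⟩)
    (fun s hs => b3 _ ⟨by linarith [hs.1], by linarith [hs.2]⟩)
  have b := side_B u u1 u2 u3 K ε E (x i) (-1) h S d1 d2 d3 (by norm_num) hh hhS
    (fun s hs => ⟨by linarith [hs.2], by linarith [hs.1]⟩) hε hK hE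
    (fun s hs => b2 _ ⟨by linarith [hs.2], by linarith [hs.1]⟩)
    (fun s hs => b3 _ ⟨by linarith [hs.2], by linarith [hs.1]⟩)
  rw [show x i + 1 * k = x i + k by ring] at a
  rw [show x i + -1 * h = x i - h by ring] at b
  have := trunc_sides _ _ _ _ _ _ _ _ hh hk a b
  rw [ddiff_form x _ i h k hp hm, hp, hm]
  calc _ ≤ ε ^ 2 * (2 * (2 * K * (S / ε + E / ε ^ 2))) :=
        mul_le_mul_of_nonneg_left this hε2.le
    _ = 4 * K * (ε * S + E) := by field_simp; ring

end claims

/-- explicit form of the Shishkin mesh with `4 m` cells. -/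
theorem mesh_form (γ ε : ℝ) (m : ℕ) (hm : 1 ≤ m) (α : ℝ)
    (hα : α = min (1/4) (2 * γ⁻¹ * ε * Real.log ((4 * m : ℕ) : ℝ))) :
    (∀ i : ℕ, i ≤ m → shishkinMesh γ ε (4 * m) i = α * i / m) ∧
    (∀ i : ℕ, m ≤ i → i ≤ 3 * m →
      shishkinMesh γ ε (4 * m) i = α + (1 - 2 * α) * (i - m) / (2 * m)) ∧
    (∀ i : ℕ, 3 * m ≤ i → i ≤ 4 * m →
      shishkinMesh γ ε (4 * m) i = 1 - α * (4 * m - i) / m) := by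
  have hmr : (0:ℝ) < m := by exact_mod_cast hm
  have key : ∀ i : ℕ, shishkinMesh γ ε (4 * m) i =
      if (i:ℝ) ≤ m then α * i / m
      else if (i:ℝ) ≤ 3 * m then α + (1 - 2 * α) * (i - m) / (2 * m)
      else 1 - α * (4 * m - i) / m := by
    intro i
    unfold shishkinMesh shishkinLam
    simp only [← hα]
    push_cast
    have e1 : ((i:ℝ) / (4 * m) ≤ 1 / 4) ↔ (i:ℝ) ≤ m := by
      rw [div_le_iff₀ (by positivity)]; constructor <;> intro <;> linarith
    have e2 : ((i:ℝ) / (4 * m) ≤ 1 / 2) ↔ (i:ℝ) ≤ 2 * m := by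
      rw [div_le_iff₀ (by positivity)]; constructor <;> intro <;> linarith
    have e3 : (1 - (i:ℝ) / (4 * m) ≤ 1 / 4) ↔ 3 * (m:ℝ) ≤ i := by
      rw [sub_le_comm, le_div_iff₀ (by positivity)]; constructor <;> intro <;> linarith
    simp only [e1, e2, e3]
    split_ifs with a b c d e <;> try (exfalso; linarith)
    · field_simp
    · field_simp; ring
    · have : (i:ℝ) = 3 * m := by linarith
      rw [this]; field_simp; ring
    · field_simp
    · field_simp; ring
  refine ⟨fun i hi => ?_, fun i h1 h2 => ?_, fun i h1 h2 => ?_⟩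
  · have : (i:ℝ) ≤ m := by exact_mod_cast hi
    rw [key, if_pos this]
  · have a1 : (m:ℝ) ≤ i := by exact_mod_cast h1
    have a2 : (i:ℝ) ≤ 3 * m := by exact_mod_cast h2
    rw [key, if_pos a2]
    split_ifs with h
    · have : (i:ℝ) = m := le_antisymm h a1
      rw [this]; field_simp; ring
    · rfl
  · have a1 : 3 * (m:ℝ) ≤ i := by exact_mod_cast h1
    rw [key, if_neg (by linarith)]
    split_ifs with h
    · have : (i:ℝ) = 3 * m := le_antisymm h a1
      rw [this]; field_simp; ring
    · rfl

section mesh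
variable (x : ℕ → ℝ) (m : ℕ) (α : ℝ)

theorem mesh_steps (hm : 1 ≤ m) (hα : 0 < α) (hα4 : α ≤ 1 / 4)
    (F1 : ∀ i : ℕ, i ≤ m → x i = α * i / m)
    (F2 : ∀ i : ℕ, m ≤ i → i ≤ 3 * m → x i = α + (1 - 2 * α) * (i - m) / (2 * m))
    (F3 : ∀ i : ℕ, 3 * m ≤ i → i ≤ 4 * m → x i = 1 - α * (4 * m - i) / m) :
    ∀ i, 1 ≤ i → i < 4 * m →
    (x (i + 1) = x i + α / m ∧ x (i - 1) = x i - α / m ∧ 0 ≤ x i - α / m ∧ x i + α / m ≤ 1) ∨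
    (x (i + 1) = x i + (1 - 2 * α) / (2 * m) ∧ x (i - 1) = x i - (1 - 2 * α) / (2 * m) ∧
      α ≤ x i - (1 - 2 * α) / (2 * m) ∧ x i + (1 - 2 * α) / (2 * m) ≤ 1 - α) ∨
    (x i = α ∧ x (i + 1) = x i + (1 - 2 * α) / (2 * m) ∧ x (i - 1) = x i - α / m) ∨
    (x i = 1 - α ∧ x (i + 1) = x i + α / m ∧ x (i - 1) = x i - (1 - 2 * α) / (2 * m)) := by
  have hmr : (0:ℝ) < m := by exact_mod_cast hm
  intro i hi hi4
  obtain ⟨j, rfl⟩ : ∃ j, i = j + 1 := ⟨i - 1, by omega⟩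
  simp only [Nat.add_sub_cancel]
  have hα1 : 0 < 1 - 2 * α := by linarith
  rcases lt_trichotomy (j + 1) m with h | h | h
  · left
    rw [F1 (j + 1 + 1) (by omega), F1 (j + 1) (by omega), F1 j (by omega)]
    push_cast
    have hj : (j:ℝ) + 2 ≤ m := by exact_mod_cast (by omega : j + 2 ≤ m)
    refine ⟨by field_simp, by field_simp; ring, ?_, ?_⟩
    · rw [← sub_div]; apply div_nonneg _ hmr.le; ring_nf; positivity
    · rw [← add_div, div_le_one hmr]; nlinarith
  · right; right; left
    have e : (m:ℝ) = j + 1 := by exact_mod_cast h.symm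
    rw [F2 (j + 1 + 1) (by omega) (by omega), F1 (j + 1) (by omega), F1 j (by omega)]
    push_cast
    refine ⟨by rw [e]; field_simp, ?_, ?_⟩
    · rw [e]; field_simp; ring
    · rw [e]; field_simp; ring
  rcases lt_trichotomy (j + 1) (3 * m) with h' | h' | h'
  · right; left
    rw [F2 (j + 1 + 1) (by omega) (by omega), F2 (j + 1) (by omega) (by omega),
      F2 j (by omega) (by omega)]
    push_cast
    have hj : (j:ℝ) + 2 ≤ 3 * m := by exact_mod_cast (by omega : j + 2 ≤ 3 * m)
    have hj' : (m:ℝ) ≤ j := by exact_mod_cast (by omega : m ≤ j)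
    refine ⟨by field_simp; ring, by field_simp; ring, ?_, ?_⟩
    · rw [add_sub_assoc, ← sub_div]
      have : 0 ≤ ((1 - 2 * α) * ((j:ℝ) + 1 - m) - (1 - 2 * α)) / (2 * m) := by
        apply div_nonneg _ (by positivity)
        nlinarith
      linarith
    · rw [add_assoc, ← add_div]
      have : ((1 - 2 * α) * ((j:ℝ) + 1 - m) + (1 - 2 * α)) / (2 * m) ≤ 1 - 2 * α := by
        rw [div_le_iff₀ (by positivity)]
        nlinarith
      linarith
  · right; right; right
    have e : (j:ℝ) = 3 * m - 1 := by
      have : (j:ℝ) + 1 = 3 * m := by exact_mod_cast h'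
      linarith
    rw [F3 (j + 1 + 1) (by omega) (by omega), F3 (j + 1) (by omega) (by omega),
      F2 j (by omega) (by omega)]
    push_cast
    rw [e]
    refine ⟨by field_simp; ring, by field_simp; ring, by field_simp; ring⟩
  · left
    rw [F3 (j + 1 + 1) (by omega) (by omega), F3 (j + 1) (by omega) (by omega),
      F3 j (by omega) (by omega)]
    push_cast
    have hj : (j:ℝ) + 2 ≤ 4 * m := by exact_mod_cast (by omega : j + 2 ≤ 4 * m)
    have hj' : 3 * (m:ℝ) ≤ j := by exact_mod_cast (by omega : 3 * m ≤ j)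
    refine ⟨by field_simp; ring, by field_simp; ring, ?_, ?_⟩
    · rw [sub_sub, ← add_div]
      have : (α * (4 * m - ((j:ℝ) + 1)) + α) / m ≤ 1 := by
        rw [div_le_one hmr]; nlinarith
      linarith
    · rw [sub_add, ← sub_div]
      have : 0 ≤ (α * (4 * m - ((j:ℝ) + 1)) - α) / m := by
        apply div_nonneg _ hmr.le; nlinarith
      linarith

theorem mesh_ends (hm : 1 ≤ m)
    (F1 : ∀ i : ℕ, i ≤ m → x i = α * i / m)
    (F3 : ∀ i : ℕ, 3 * m ≤ i → i ≤ 4 * m → x i = 1 - α * (4 * m - i) / m) :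
    x 0 = 0 ∧ x (4 * m) = 1 := by
  constructor
  · rw [F1 0 (by omega)]; simp
  · rw [F3 (4 * m) (by omega) le_rfl]; push_cast; simp

theorem mesh_mono (hm : 1 ≤ m) (hα : 0 < α) (hα4 : α ≤ 1 / 4)
    (F1 : ∀ i : ℕ, i ≤ m → x i = α * i / m)
    (F2 : ∀ i : ℕ, m ≤ i → i ≤ 3 * m → x i = α + (1 - 2 * α) * (i - m) / (2 * m))
    (F3 : ∀ i : ℕ, 3 * m ≤ i → i ≤ 4 * m → x i = 1 - α * (4 * m - i) / m) :
    ∀ i < 4 * m, x i < x (i + 1) := by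
  have hmr : (0:ℝ) < m := by exact_mod_cast hm
  have p1 : 0 < α / m := by positivity
  have p2 : 0 < (1 - 2 * α) / (2 * m) := div_pos (by linarith) (by positivity)
  intro i hi
  rcases Nat.eq_zero_or_pos i with rfl | h
  · rw [F1 0 (by omega), F1 (0 + 1) (by omega)]; push_cast; simpa using p1
  · rcases mesh_steps x m α hm hα hα4 F1 F2 F3 i h hi with h | h | h | h
    · linarith [h.1]
    · linarith [h.1]
    · linarith [h.2.1]
    · linarith [h.2.1]

theorem mesh_mem (hx : ∀ i < 4 * m, x i < x (i + 1)) (h0 : x 0 = 0)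
    (h1 : x (4 * m) = 1) : ∀ i ≤ 4 * m, x i ∈ Icc (0:ℝ) 1 := by
  have up : ∀ i ≤ 4 * m, 0 ≤ x i := by
    intro i
    induction i with
    | zero => intro _; rw [h0]
    | succ k ih => intro hk; linarith [ih (by omega), hx k (by omega)]
  have dn : ∀ j ≤ 4 * m, x (4 * m - j) ≤ 1 := by
    intro j
    induction j with
    | zero => intro _; rw [Nat.sub_zero, h1]
    | succ k ih =>
      intro hk
      have a := hx (4 * m - (k + 1)) (by omega)
      rw [show 4 * m - (k + 1) + 1 = 4 * m - k by omega] at a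
      linarith [ih (by omega)]
  intro i hi
  refine ⟨up i hi, ?_⟩
  have := dn (4 * m - i) (by omega)
  rwa [show 4 * m - (4 * m - i) = i by omega] at this

/-- the hat-type barrier is discretely concave. -/
theorem barrier_concave (i : ℕ) (h k : ℝ) (hp : x (i + 1) = x i + k)
    (hm : x (i - 1) = x i - h) (hh : 0 < h) (hk : 0 < k) :
    ddiff x (fun j => min (min (x j) (1 - x j)) α) i ≤ 0 := by
  rw [ddiff_form x _ i h k hp hm]
  set g : ℝ → ℝ := fun t => min (min t (1 - t)) α with hg
  have hp' : ∃ p : ℝ, ∀ s, g (x i + s) ≤ g (x i) + p * s := by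
    rcases min_choice (min (x i) (1 - x i)) α with e | e
    · rcases min_choice (x i) (1 - x i) with e' | e'
      · refine ⟨1, fun s => ?_⟩
        simp only [hg]
        rw [e, e']
        exact ((min_le_left _ _).trans (min_le_left _ _)).trans (by linarith)
      · refine ⟨-1, fun s => ?_⟩
        simp only [hg]
        rw [e, e']
        exact ((min_le_left _ _).trans (min_le_right _ _)).trans (by linarith)
    · refine ⟨0, fun s => ?_⟩
      simp only [hg]
      rw [e]
      exact (min_le_right _ _).trans (by linarith)
  obtain ⟨p, H⟩ := hp'
  have a := H k
  have b := H (-h)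
  change 2 / (k + h) * ((g (x (i + 1)) - g (x i)) / k - (g (x i) - g (x (i - 1))) / h) ≤ 0
  rw [hp, hm]
  rw [← sub_eq_add_neg] at b
  apply mul_nonpos_of_nonneg_of_nonpos (by positivity)
  have a' : (g (x i + k) - g (x i)) / k ≤ p := by rw [div_le_iff₀ hk]; linarith
  have b' : p ≤ (g (x i) - g (x i - h)) / h := by rw [le_div_iff₀ hh]; linarith
  linarith

theorem barrier_left (i : ℕ) (h k : ℝ) (hp : x (i + 1) = x i + k)
    (hm : x (i - 1) = x i - h) (hh : 0 < h) (hk : 0 < k) (hα4 : α ≤ 1 / 4) (hi : x i = α) :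
    ddiff x (fun j => min (min (x j) (1 - x j)) α) i ≤ -(2 / (k + h)) := by
  rw [ddiff_form x _ i h k hp hm]
  rw [hp, hm, hi]
  have e1 : min (min α (1 - α)) α = α := by
    rw [min_eq_right]; exact le_min le_rfl (by linarith)
  have e2 : min (min (α - h) (1 - (α - h))) α ≤ α - h :=
    (min_le_left _ _).trans (min_le_left _ _)
  have e3 : min (min (α + k) (1 - (α + k))) α ≤ α := min_le_right _ _
  rw [e1]
  have a' : (min (min (α + k) (1 - (α + k))) α - α) / k ≤ 0 :=
    div_nonpos_of_nonpos_of_nonneg (by linarith) hk.le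
  have b' : 1 ≤ (α - min (min (α - h) (1 - (α - h))) α) / h := by
    rw [le_div_iff₀ hh]; linarith
  have : 0 < 2 / (k + h) := by positivity
  nlinarith

theorem barrier_right (i : ℕ) (h k : ℝ) (hp : x (i + 1) = x i + k)
    (hm : x (i - 1) = x i - h) (hh : 0 < h) (hk : 0 < k) (hα4 : α ≤ 1 / 4) (hi : x i = 1 - α) :
    ddiff x (fun j => min (min (x j) (1 - x j)) α) i ≤ -(2 / (k + h)) := by
  rw [ddiff_form x _ i h k hp hm]
  rw [hp, hm, hi]
  have e1 : min (min (1 - α) (1 - (1 - α))) α = α := by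
    rw [min_eq_right]; exact le_min (by linarith) (by linarith)
  have e2 : min (min (1 - α + k) (1 - (1 - α + k))) α ≤ α - k :=
    ((min_le_left _ _).trans (min_le_right _ _)).trans (by linarith)
  have e3 : min (min (1 - α - h) (1 - (1 - α - h))) α ≤ α := min_le_right _ _
  rw [e1]
  have a' : (min (min (1 - α + k) (1 - (1 - α + k))) α - α) / k ≤ -1 := by
    rw [div_le_iff₀ hk]; linarith
  have b' : 0 ≤ (α - min (min (1 - α - h) (1 - (1 - α - h))) α) / h :=
    div_nonneg (by linarith) hh.le
  have : 0 < 2 / (k + h) := by positivity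
  nlinarith

end mesh

/-- the layer function is `O(N⁻²)` outside the fine part of the mesh. -/
theorem layer_small (c γ ε α l N t : ℝ) (hε : 0 < ε) (hγ : 0 < γ) (hγc : γ ≤ c)
    (hN : 0 < N) (hl : l = Real.log N) (hlN : l ≤ N) (hα : α = 2 * γ⁻¹ * ε * l)
    (hαp : 0 < α)
    (ht0 : α - α * 4 / N ≤ t) (ht1 : t ≤ 1 - (α - α * 4 / N)) :
    layer c ε t ≤ 2 * Real.exp (8 * c / γ) / N ^ 2 := by
  have hc : 0 < c := by linarith
  have hlp : 0 ≤ l := by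
    by_contra hneg
    push Not at hneg
    have : 2 * γ⁻¹ * ε * l < 0 := mul_neg_of_pos_of_neg (by positivity) hneg
    linarith
  have key : Real.exp (-c * (α - α * 4 / N) / ε) ≤ Real.exp (8 * c / γ) / N ^ 2 := by
    have e : Real.exp (8 * c / γ) / N ^ 2 = Real.exp (8 * c / γ - 2 * l) := by
      rw [Real.exp_sub, show 2 * l = l + l by ring, Real.exp_add, hl, Real.exp_log hN, sq]
    rw [e]
    apply Real.exp_le_exp.2
    have e2 : -c * (α - α * 4 / N) / ε = 8 * c / γ * (l / N) - 2 * l * (c / γ) := by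
      rw [hα]; field_simp; ring
    rw [e2]
    have q1 : l / N ≤ 1 := by rwa [div_le_one hN]
    have q2 : 1 ≤ c / γ := by rwa [one_le_div hγ]
    have q3 : 0 ≤ 8 * c / γ := by positivity
    nlinarith
  have mono : ∀ s, α - α * 4 / N ≤ s → Real.exp (-c * s / ε) ≤ Real.exp (8 * c / γ) / N ^ 2 := by
    intro s hs
    refine le_trans (Real.exp_le_exp.2 ?_) key
    apply div_le_div_of_nonneg_right _ hε.le
    nlinarith
  unfold layer
  have := mono t ht0
  have := mono (1 - t) (by linarith)
  rw [show 2 * Real.exp (8 * c / γ) / N ^ 2 = 2 * (Real.exp (8 * c / γ) / N ^ 2) by ring]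
  linarith

set_option maxHeartbeats 2000000 in
/-- the nonlinear discrete scheme on the Shishkin mesh with
`γ₀ = min(c₀,1)` has a unique solution and converges ε-uniformly with order
two up to a logarithmic factor. -/
theorem stmt_13 (f : ℝ → ℝ → ℝ) (c₀ : ℝ) (hc₀ : 0 < c₀)
    (hf : SmoothF f) (hfu : LowerF f c₀) :
    ∃ C : ℝ, 0 < C ∧
      ∀ ε ∈ Ioc (0:ℝ) 1, ∀ n : ℕ, 4 ≤ n → 4 ∣ n →
      ∀ u : ℝ → ℝ, IsSolution f ε u →
        (∃ y : ℕ → ℝ, NonlinScheme f ε (shishkinMesh (min c₀ 1) ε n) n y) ∧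
        (∀ y y' : ℕ → ℝ,
          NonlinScheme f ε (shishkinMesh (min c₀ 1) ε n) n y →
          NonlinScheme f ε (shishkinMesh (min c₀ 1) ε n) n y' →
          ∀ i ≤ n, y i = y' i) ∧
        (∀ y : ℕ → ℝ,
          NonlinScheme f ε (shishkinMesh (min c₀ 1) ε n) n y →
          ∀ i ≤ n,
            |u (shishkinMesh (min c₀ 1) ε n i) - y i| ≤
              C * ((n:ℝ) ^ 2)⁻¹ * (Real.log n) ^ 2) := by
  obtain ⟨K, hK, hreg⟩ := regularity f c₀ hc₀ hf hfu
  have hsm := strong_mono f c₀ hf hfu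
  set γ := min c₀ 1 with hγdef
  have hγ : 0 < γ := lt_min hc₀ one_pos
  have hγc : γ ≤ c₀ := min_le_left _ _
  set K2 : ℝ := 2 * Real.exp (8 * c₀ / γ) with hK2
  have hK2p : 0 < K2 := by positivity
  set D : ℝ := 384 * K / γ ^ 2 + 4 * K * (4 + K2) + 4 * K * K2 with hD
  have hDp : 0 < D := by positivity
  refine ⟨D / c₀ ^ 2 + 16 * K / γ, by positivity, ?_⟩
  intro ε hε n hn4 hdvd u hu
  obtain ⟨m, rfl⟩ := hdvd
  have hm : 1 ≤ m := by omega
  have hmr : (1:ℝ) ≤ m := by exact_mod_cast hm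
  have hm0 : (0:ℝ) < m := by linarith
  set x := shishkinMesh γ ε (4 * m) with hx
  obtain ⟨α, hα⟩ : ∃ α, α = min (1/4) (2 * γ⁻¹ * ε * Real.log ((4 * m : ℕ) : ℝ)) := ⟨_, rfl⟩
  obtain ⟨F1, F2, F3⟩ := mesh_form γ ε m hm α hα
  rw [← hx] at F1 F2 F3
  clear_value x
  set N : ℝ := ((4 * m : ℕ) : ℝ) with hN
  have hNm : N = 4 * m := by rw [hN]; push_cast; rfl
  have hN4 : 4 ≤ N := by linarith
  have hN0 : 0 < N := by linarith
  set l : ℝ := Real.log N with hl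
  have hl1 : 1 ≤ l := by
    rw [hl, Real.le_log_iff_exp_le hN0]
    linarith [Real.exp_one_lt_d9]
  have hlN : l ≤ N := Real.log_le_self hN0.le
  clear_value l N
  have hε0 := hε.1
  have hε1 := hε.2
  have hε2 : 0 < ε ^ 2 := by positivity
  have hα4 : α ≤ 1 / 4 := by rw [hα]; exact min_le_left _ _
  have hα2 : α ≤ 2 * γ⁻¹ * ε * l := by rw [hα]; exact min_le_right _ _
  have hα0 : 0 < α := by rw [hα]; exact lt_min (by norm_num) (by positivity)
  have hstep := mesh_steps x m α hm hα0 hα4 F1 F2 F3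
  have hmono := mesh_mono x m α hm hα0 hα4 F1 F2 F3
  obtain ⟨hx0, hx1⟩ := mesh_ends x m α hm F1 F3
  have hmem := mesh_mem x m hmono hx0 hx1
  have hfs : ∀ i ≤ 4 * m, ∀ a b, a < b → f (x i) a < f (x i) b := fun i hi a b hab => by
    have := (hsm (x i) (hmem i hi)).2 a b hab.le
    have : 0 < c₀ ^ 2 * (b - a) := mul_pos (by positivity) (by linarith)
    linarith
  refine ⟨?_, ?_, ?_⟩
  · exact disc_exists f ε x (4 * m) (by omega) hε0 hmono
      (fun i hi => (hsm (x i) (hmem i hi)).1)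
      (fun i hi a b hab => by
        rcases hab.eq_or_lt with rfl | h
        · exact le_rfl
        · exact (hfs i hi a b h).le)
  · intro y y' hy hy' i hi
    apply le_antisymm
    · exact disc_comparison f ε x (4 * m) y' y hmono hfs
        (fun i h1 h2 => by rw [hy.1 i h1 h2, hy'.1 i h1 h2]) (by rw [hy.2.1, hy'.2.1])
        (by rw [hy.2.2, hy'.2.2]) i hi
    · exact disc_comparison f ε x (4 * m) y y' hmono hfs
        (fun i h1 h2 => by rw [hy.1 i h1 h2, hy'.1 i h1 h2]) (by rw [hy.2.1, hy'.2.1])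
        (by rw [hy.2.2, hy'.2.2]) i hi
  intro y hy
  obtain ⟨u1, u2, u3, u4, d1, d2, d3, d4, hfu2, hb⟩ := hreg ε hε u hu
  set h : ℝ := α / m with hh
  set H : ℝ := (1 - 2 * α) / (2 * m) with hH
  have hhp : 0 < h := by rw [hh]; positivity
  have hHp : 0 < H := by rw [hH]; exact div_pos (by linarith) (by positivity)
  have hsum : h + H = 2 / N := by rw [hh, hH, hNm]; field_simp; ring
  have hN4a : h = α * 4 / N := by rw [hh, hNm]; field_simp
  have hhα : h ≤ α := by rw [hh, div_le_iff₀ hm0]; nlinarith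
  have hHα : H ≤ 1 - 2 * α := by rw [hH, div_le_iff₀ (by positivity)]; nlinarith
  have hfine : ∀ i, x (i + 1) = x i + h → x (i - 1) = x i - h → 0 ≤ x i - h → x i + h ≤ 1 →
      ε ^ 2 * |ddiff x (fun j => u (x j)) i - u2 (x i)| ≤ 384 * K / γ ^ 2 * (l ^ 2 / N ^ 2) := by
    intro i hp hmi h0 h1
    have key := claim_unif u u1 u2 u3 u4 x i h d1 d2 d3 d4 hp hmi hhp h0 h1 (3 * K / ε ^ 4)
      (fun t ht => by
        have htI : t ∈ Icc (0:ℝ) 1 := ⟨by linarith [ht.1], by linarith [ht.2]⟩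
        refine (hb t htI).2.2.trans ?_
        have hlay : layer c₀ ε t ≤ 2 := by
          have e1 : Real.exp (-c₀ * t / ε) ≤ 1 := Real.exp_le_one_iff.2
            (div_nonpos_of_nonpos_of_nonneg (by nlinarith [htI.1]) hε0.le)
          have e2 : Real.exp (-c₀ * (1 - t) / ε) ≤ 1 := Real.exp_le_one_iff.2
            (div_nonpos_of_nonpos_of_nonneg (by nlinarith [htI.2]) hε0.le)
          unfold layer; linarith
        have e3 : ε ^ 2 ≤ 1 := pow_le_one₀ hε0.le hε1
        calc K / ε ^ 2 * (1 + layer c₀ ε t / ε ^ 2) ≤ K / ε ^ 2 * (1 + 2 / ε ^ 2) := by gcongr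
          _ = K * (ε ^ 2 + 2) / ε ^ 4 := by field_simp
          _ ≤ 3 * K / ε ^ 4 := by
            apply div_le_div_of_nonneg_right _ (by positivity)
            nlinarith)
    have hhe : h ≤ 8 * γ⁻¹ * ε * l / N := by
      rw [hN4a]
      apply div_le_div_of_nonneg_right _ hN0.le
      linarith
    calc ε ^ 2 * |ddiff x (fun j => u (x j)) i - u2 (x i)|
        ≤ ε ^ 2 * (2 * (3 * K / ε ^ 4) * h ^ 2) := mul_le_mul_of_nonneg_left key hε2.le
      _ ≤ ε ^ 2 * (2 * (3 * K / ε ^ 4) * (8 * γ⁻¹ * ε * l / N) ^ 2) := by gcongr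
      _ = 384 * K / γ ^ 2 * (l ^ 2 / N ^ 2) := by field_simp; norm_num
  set g : ℕ → ℝ := fun j => min (min (x j) (1 - x j)) α with hg
  have hg0 : ∀ j ≤ 4 * m, 0 ≤ g j := fun j hj =>
    le_min (le_min (hmem j hj).1 (by linarith [(hmem j hj).2])) hα0.le
  have hg1 : ∀ j, g j ≤ α := fun j => min_le_right _ _
  set A : ℝ := D / c₀ ^ 2 * (l ^ 2 / N ^ 2) with hA
  set A' : ℝ := 16 * K / γ * (l / N ^ 2) with hA'
  have hA0 : 0 ≤ A := by positivity
  have hA'0 : 0 ≤ A' := by positivity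
  have hAc : c₀ ^ 2 * A = D * (l ^ 2 / N ^ 2) := by rw [hA]; field_simp
  have hll : l ^ 2 / N ^ 2 ≥ 1 / N ^ 2 := by
    apply div_le_div_of_nonneg_right _ (by positivity); nlinarith
  have hlp : 0 < l ^ 2 / N ^ 2 := by positivity
  have hE : 0 ≤ K2 / N ^ 2 := by positivity
  have herr := error_lemma f c₀ ε x (4 * m) (fun j => u (x j)) y
    (fun j => A + A' / α * g j) (fun j => u2 (x j)) hc₀ hmono
    (fun i hi => (hsm (x i) (hmem i hi)).2) (fun i hi => hfu2 _ (hmem i hi))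
    (by show u (x 0) = 0; rw [hx0]; exact hu.2.2.1)
    (by show u (x (4 * m)) = 0; rw [hx1]; exact hu.2.2.2) hy
    (fun i hi => by have := hg0 i hi; positivity) ?_
  · intro i hi
    refine (herr i hi).trans ?_
    have e1 : A' / α * g i ≤ A' := by
      rw [div_mul_eq_mul_div, div_le_iff₀ hα0]
      exact mul_le_mul_of_nonneg_left (hg1 i) hA'0
    have e2 : A' ≤ 16 * K / γ * (l ^ 2 / N ^ 2) := by
      rw [hA']; gcongr; nlinarith
    have e3 : (D / c₀ ^ 2 + 16 * K / γ) * (N ^ 2)⁻¹ * l ^ 2 =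
      A + 16 * K / γ * (l ^ 2 / N ^ 2) := by rw [hA]; ring
    rw [e3]
    show A + A' / α * g i ≤ _
    linarith
  · intro i h1 h2
    rw [ddiff_affine]
    have hq : c₀ ^ 2 * A ≤ c₀ ^ 2 * (A + A' / α * g i) := by
      have := hg0 i h2.le
      gcongr
      have : 0 ≤ A' / α * g i := by positivity
      linarith
    rw [hAc] at hq
    have hgen : ∀ z, ddiff x g i ≤ -z → ε ^ 2 * (A' / α * z) ≤ -ε ^ 2 * (A' / α * ddiff x g i) := by
      intro z hz
      have : A' / α * z ≤ A' / α * (-ddiff x g i) :=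
        mul_le_mul_of_nonneg_left (by linarith) (by positivity)
      nlinarith
    have hD1 : 384 * K / γ ^ 2 * (l ^ 2 / N ^ 2) ≤ D * (l ^ 2 / N ^ 2) := by
      gcongr; rw [hD]
      have : 0 < 4 * K * (4 + K2) + 4 * K * K2 := by positivity
      linarith
    -- the uniform fine situation closes the goal
    have fin : x (i + 1) = x i + h → x (i - 1) = x i - h → 0 ≤ x i - h → x i + h ≤ 1 →
        ε ^ 2 * |ddiff x (fun j => u (x j)) i - u2 (x i)| ≤
        -ε ^ 2 * (A' / α * ddiff x g i) + c₀ ^ 2 * (A + A' / α * g i) := by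
      intro a1 a2 a3 a4
      have b1 := hfine i a1 a2 a3 a4
      have b2 := hgen 0 (by simpa using barrier_concave x α i h h a1 a2 hhp hhp)
      simp only [mul_zero] at b2
      linarith
    rcases hα4.eq_or_lt with hαe | hαlt
    · have hHh : H = h := by rw [hH, hh, hαe]; field_simp; norm_num
      rw [hHh] at hstep hHα
      rcases hstep i h1 h2 with s | s | s | s
      · exact fin s.1 s.2.1 s.2.2.1 s.2.2.2
      · exact fin s.1 s.2.1 (by linarith [s.2.2.1]) (by linarith [s.2.2.2])
      · exact fin s.2.1 s.2.2 (by linarith [s.1]) (by linarith [s.1])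
      · exact fin s.2.1 s.2.2 (by linarith [s.1]) (by linarith [s.1])
    have hαeq : α = 2 * γ⁻¹ * ε * l := by
      rw [hα] at hαlt ⊢
      rcases min_lt_iff.1 hαlt with q | q
      · exact absurd q (lt_irrefl _)
      · exact min_eq_right q.le
    have hlay : ∀ t, α - h ≤ t → t ≤ 1 - (α - h) → layer c₀ ε t ≤ K2 / N ^ 2 := by
      intro t t1 t2
      rw [hN4a] at t1 t2
      exact layer_small c₀ γ ε α l N t hε0 hγ hγc hN0 hl hlN hαeq hα0 t1 t2
    have hbd : ∀ t, α - h ≤ t → t ≤ 1 - (α - h) →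
        |u2 t| ≤ K * (1 + K2 / N ^ 2 / ε ^ 2) ∧ |u3 t| ≤ K / ε * (1 + K2 / N ^ 2 / ε ^ 2) ∧
        |u4 t| ≤ K / ε ^ 2 * (1 + K2 / N ^ 2 / ε ^ 2) := by
      intro t t1 t2
      have q := hlay t t1 t2
      obtain ⟨r1, r2, r3⟩ := hb t ⟨by linarith, by linarith⟩
      refine ⟨r1.trans ?_, r2.trans ?_, r3.trans ?_⟩ <;> gcongr
    have hHN : H ≤ 2 / N := by linarith
    have hhN : h ≤ 2 / N := by linarith
    have htr : ε ^ 2 * (A' / α * N) = 4 * K * (ε * (2 / N)) := by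
      rw [hA', hαeq]; field_simp; norm_num
    have hD3 : 4 * K * (K2 / N ^ 2) ≤ D * (l ^ 2 / N ^ 2) := by
      calc 4 * K * (K2 / N ^ 2) = 4 * K * K2 * (1 / N ^ 2) := by ring
        _ ≤ 4 * K * K2 * (l ^ 2 / N ^ 2) := by gcongr
        _ ≤ _ := by
          gcongr; rw [hD]
          have : 0 < 384 * K / γ ^ 2 + 4 * K * (4 + K2) := by positivity
          linarith
    rcases hstep i h1 h2 with s | s | s | s
    · exact fin s.1 s.2.1 s.2.2.1 s.2.2.2
    · obtain ⟨s1, s2, s3, s4⟩ := s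
      have b1 := claim_coarse u u1 u2 u3 u4 x i H K ε (K2 / N ^ 2) d1 d2 d3 d4 s1 s2 hHp
        (by linarith) (by linarith) hε0 hK hE
        (fun t ht => (hbd t (by linarith [ht.1]) (by linarith [ht.2])).1)
        (fun t ht => (hbd t (by linarith [ht.1]) (by linarith [ht.2])).2.2)
      have b2 := hgen 0 (by simpa using barrier_concave x α i H H s1 s2 hHp hHp)
      simp only [mul_zero] at b2
      have b3 : 4 * K * (H ^ 2 + K2 / N ^ 2) ≤ D * (l ^ 2 / N ^ 2) := by
        calc 4 * K * (H ^ 2 + K2 / N ^ 2) ≤ 4 * K * ((2 / N) ^ 2 + K2 / N ^ 2) := by gcongr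
          _ = 4 * K * (4 + K2) * (1 / N ^ 2) := by ring
          _ ≤ 4 * K * (4 + K2) * (l ^ 2 / N ^ 2) := by gcongr
          _ ≤ _ := by
            gcongr; rw [hD]
            have : 0 < 384 * K / γ ^ 2 + 4 * K * K2 := by positivity
            linarith
      linarith
    · obtain ⟨s0, s1, s2⟩ := s
      have b1 := claim_trans u u1 u2 u3 x i h H K ε (K2 / N ^ 2) (2 / N) d1 d2 d3 s1 s2 hhp hHp
        hhN hHN (by linarith) (by linarith) hε0 hK hE
        (fun t ht => (hbd t (by linarith [ht.1]) (by linarith [ht.2])).1)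
        (fun t ht => (hbd t (by linarith [ht.1]) (by linarith [ht.2])).2.1)
      have b2 := barrier_left x α i h H s1 s2 hhp hHp hα4 s0
      rw [add_comm H h, hsum, show 2 / (2 / N) = N by field_simp] at b2
      have b3 := hgen N b2
      linarith
    · obtain ⟨s0, s1, s2⟩ := s
      have b1 := claim_trans u u1 u2 u3 x i H h K ε (K2 / N ^ 2) (2 / N) d1 d2 d3 s1 s2 hHp hhp
        hHN hhN (by linarith) (by linarith) hε0 hK hE
        (fun t ht => (hbd t (by linarith [ht.1]) (by linarith [ht.2])).1)
        (fun t ht => (hbd t (by linarith [ht.1]) (by linarith [ht.2])).2.1)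
      have b2 := barrier_right x α i H h s1 s2 hHp hhp hα4 s0
      rw [hsum, show 2 / (2 / N) = N by field_simp] at b2
      have b3 := hgen N b2
      linarith
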